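/- arXiv:1305.6588 — 2 statements merged into one kernel-verified Lean document; each statement's English description precedes it below -/
import Mathlib

section
/- Let 0 < α < β ≤ 1 and p₁, p₂ > 0 with p₁ + p₂ = 1. Then the skew product S admits a unique absolutely continuous invariant probability measure: there exists exactly one Borel probability measure ν on [0,1]×[0,1] that is absolutely continuous with respect to two-dimensional Lebesgue measure and satisfies ν(S⁻¹(A)) = ν(A) for every Borel set A ⊆ [0,1]×[0,1]. -/
noncomputable section

open Real MeasureTheory Set Filter

/-- The LSV map `T_γ` on `[0,1]`: `x(1+2^γ x^γ)` on `[0,1/2]`, `2x-1` on `(1/2,1]`. -/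
noncomputable def lsv (γ : ℝ) (x : ℝ) : ℝ :=
  if x ≤ 1 / 2 then x * (1 + 2 ^ γ * x ^ γ) else 2 * x - 1

/-- The left branch of the LSV map. -/
noncomputable def lsvLeft (γ : ℝ) (x : ℝ) : ℝ := x * (1 + 2 ^ γ * x ^ γ)

/-- The random parameter selection: `α` for `ω ∈ [0,p₁)`, `β` for `ω ∈ [p₁,1]`. -/
noncomputable def sel (α β p₁ : ℝ) (ω : ℝ) : ℝ := if ω < p₁ then α else β

/-- The randomizing map `φ` on `[0,1]`. -/
noncomputable def phiMap (p₁ p₂ : ℝ) (ω : ℝ) : ℝ :=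
  if ω < p₁ then ω / p₁ else (ω - p₁) / p₂

/-- The skew product `S(x,ω) = (T_{α(ω)}(x), φ(ω))`. -/
noncomputable def skew (α β p₁ p₂ : ℝ) (z : ℝ × ℝ) : ℝ × ℝ :=
  (lsv (sel α β p₁ z.2) z.1, phiMap p₁ p₂ z.2)

/-- Random iterates: `randIter n ω = T_ω^n = T_{α(φ^{n-1}ω)} ∘ ⋯ ∘ T_{α(ω)}`. -/
noncomputable def randIter (α β p₁ p₂ : ℝ) : ℕ → ℝ → ℝ → ℝ
  | 0, _, x => x
  | n + 1, ω, x => randIter α β p₁ p₂ n (phiMap p₁ p₂ ω) (lsv (sel α β p₁ ω) x)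

/-- The deterministic backward orbit `x_n^γ`: `x₀^γ = 1`, `x₁^γ = 1/2`, and for `n ≥ 2`,
`x_n^γ` is the (unique) point of `(0,1/2]` with `T_γ(x_n^γ) = x_{n-1}^γ`. -/
def IsDetBackOrbit (γ : ℝ) (x : ℕ → ℝ) : Prop :=
  x 0 = 1 ∧ x 1 = 1 / 2 ∧
    ∀ n, 2 ≤ n → x n ∈ Set.Ioc (0 : ℝ) (1 / 2) ∧ lsv γ (x n) = x (n - 1)

/-- The random backward orbit `x_n(ω)`: `x₀(ω) = 1`, `x₁(ω) = 1/2`, and for `n ≥ 2`,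
`x_n(ω)` is the (unique) point of `(0,1/2]` with `T_{α(ω)}(x_n(ω)) = x_{n-1}(φω)`. -/
def IsRandBackOrbit (α β p₁ p₂ : ℝ) (X : ℕ → ℝ → ℝ) : Prop :=
  (∀ ω, X 0 ω = 1) ∧ (∀ ω, X 1 ω = 1 / 2) ∧
    ∀ n, 2 ≤ n → ∀ ω, X n ω ∈ Set.Ioc (0 : ℝ) (1 / 2) ∧
      lsv (sel α β p₁ ω) (X n ω) = X (n - 1) (phiMap p₁ p₂ ω)

/-- The points `x'_n(ω)`: `x'₀(ω) = 1`, `x'₁(ω) = 3/4`, and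
`x'_n(ω) = (x_n(φω) + 1)/2` for `n ≥ 2`. -/
def IsRandBackOrbitPrime (p₁ p₂ : ℝ) (X X' : ℕ → ℝ → ℝ) : Prop :=
  (∀ ω, X' 0 ω = 1) ∧ (∀ ω, X' 1 ω = 3 / 4) ∧
    ∀ n, 2 ≤ n → ∀ ω, X' n ω = (X n (phiMap p₁ p₂ ω) + 1) / 2

/-- First return time of `(x,ω)` to `(1/2,1] × [0,1]` under the skew product. -/
noncomputable def returnTime (α β p₁ p₂ : ℝ) (x ω : ℝ) : ℕ :=
  sInf {k : ℕ | 1 ≤ k ∧ 1 / 2 < randIter α β p₁ p₂ k ω x}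

namespace SkewAcip

/-! ### One-dimensional facts on the LSV maps -/

lemma measurable_lsv (γ : ℝ) : Measurable (lsv γ) := by
  unfold lsv
  exact Measurable.ite measurableSet_Iic (by fun_prop) (by fun_prop)

lemma measurable_phi (p₁ p₂ : ℝ) : Measurable (phiMap p₁ p₂) := by
  unfold phiMap
  exact Measurable.ite measurableSet_Iio (by fun_prop) (by fun_prop)

lemma measurable_skew (α β p₁ p₂ : ℝ) : Measurable (skew α β p₁ p₂) := by
  have h : skew α β p₁ p₂ = fun z : ℝ × ℝ =>
      (if z.2 < p₁ then lsv α z.1 else lsv β z.1, phiMap p₁ p₂ z.2) := by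
    funext z
    simp only [skew, sel]
    split_ifs <;> rfl
  rw [h]
  refine Measurable.prodMk ?_ ((measurable_phi p₁ p₂).comp measurable_snd)
  exact Measurable.ite (measurableSet_lt measurable_snd measurable_const)
    ((measurable_lsv α).comp measurable_fst) ((measurable_lsv β).comp measurable_fst)

lemma lsv_eq {γ x : ℝ} (h0 : 0 ≤ x) (h : x ≤ 1 / 2) : lsv γ x = x + x * (2 * x) ^ γ := by
  unfold lsv
  rw [if_pos h, Real.mul_rpow (by norm_num) h0]
  ring

lemma lsv_right {γ x : ℝ} (h : 1 / 2 < x) : lsv γ x = 2 * x - 1 := by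
  unfold lsv
  rw [if_neg (not_le.mpr h)]

lemma lsv_zero (γ : ℝ) : lsv γ 0 = 0 := by
  rw [lsv_eq le_rfl (by norm_num)]; simp

lemma lsv_half (γ : ℝ) : lsv γ (1 / 2) = 1 := by
  rw [lsv_eq (by norm_num) le_rfl]; norm_num

/-- expansion estimate on the left branch -/
lemma lsv_expand {γ x y : ℝ} (hγ : 0 < γ) (hγ1 : γ ≤ 1) (hy : 0 ≤ y) (hyx : y ≤ x)
    (hx : x ≤ 1 / 2) : (x - y) * (1 + 2 * (x - y)) ≤ lsv γ x - lsv γ y := by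
  rw [lsv_eq (hy.trans hyx) hx, lsv_eq hy (hyx.trans hx)]
  have h1 : (2 * y) ^ γ ≤ (2 * x) ^ γ :=
    Real.rpow_le_rpow (by linarith) (by linarith) hγ.le
  have h2 : 2 * x ≤ (2 * x) ^ γ := by
    rcases eq_or_lt_of_le (hy.trans hyx) with h | h
    · rw [← h]; simpa using Real.rpow_nonneg (le_refl (0:ℝ)) γ
    · calc 2 * x = (2 * x) ^ (1 : ℝ) := (Real.rpow_one _).symm
        _ ≤ _ := Real.rpow_le_rpow_of_exponent_ge (by linarith) (by linarith) hγ1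
  have h3 : y * (2 * y) ^ γ ≤ y * (2 * x) ^ γ := mul_le_mul_of_nonneg_left h1 hy
  nlinarith [mul_le_mul_of_nonneg_left h2 (sub_nonneg.mpr hyx), mul_nonneg (sub_nonneg.mpr hyx) hy]

lemma lsv_strictMonoOn {γ : ℝ} (hγ : 0 < γ) (hγ1 : γ ≤ 1) :
    StrictMonoOn (lsv γ) (Icc 0 (1 / 2)) := by
  intro y hy x hx hyx
  have := lsv_expand hγ hγ1 hy.1 hyx.le hx.2
  nlinarith [sub_pos.mpr hyx]

lemma lsv_continuousOn {γ : ℝ} (hγ : 0 < γ) : ContinuousOn (lsv γ) (Icc 0 (1 / 2)) := by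
  have : ContinuousOn (fun x : ℝ => x + x * (2 * x) ^ γ) (Icc 0 (1 / 2)) := by
    apply Continuous.continuousOn
    have := (Real.continuous_rpow_const hγ.le).comp (continuous_const_mul (2:ℝ))
    exact continuous_id.add (continuous_id.mul this)
  exact this.congr (fun x hx => lsv_eq hx.1 hx.2)

lemma lsv_convexOn {γ : ℝ} (hγ : 0 < γ) : ConvexOn ℝ (Icc 0 (1 / 2)) (lsv γ) := by
  have h1 : ConvexOn ℝ (Ici 0) (fun x : ℝ => x + 2 ^ γ * x ^ (1 + γ)) := by
    refine (convexOn_id (convex_Ici 0)).add ?_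
    exact (convexOn_rpow (by linarith)).smul (by positivity)
  refine (h1.subset (fun x hx => hx.1) (convex_Icc _ _)).congr (fun x hx => ?_)
  simp only
  rw [lsv_eq hx.1 hx.2, Real.mul_rpow (by norm_num) hx.1,
    Real.rpow_add_of_nonneg hx.1 (by norm_num) hγ.le, Real.rpow_one]
  ring

lemma exists_inv {γ : ℝ} (hγ : 0 < γ) (x : ℝ) :
    ∃ y, x ∈ Icc (0 : ℝ) 1 → y ∈ Icc (0 : ℝ) (1 / 2) ∧ lsv γ y = x := by
  by_cases hx : x ∈ Icc (0 : ℝ) 1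
  · have := intermediate_value_Icc (by norm_num : (0:ℝ) ≤ 1 / 2) (lsv_continuousOn hγ)
    rw [lsv_zero, lsv_half] at this
    obtain ⟨y, hy, h⟩ := this hx
    exact ⟨y, fun _ => ⟨hy, h⟩⟩
  · exact ⟨0, fun h => absurd h hx⟩

/-- The inverse of the left branch. -/
def linv {γ : ℝ} (hγ : 0 < γ) (x : ℝ) : ℝ := (exists_inv hγ x).choose

lemma linv_mem {γ x : ℝ} (hγ : 0 < γ) (hx : x ∈ Icc (0 : ℝ) 1) :
    linv hγ x ∈ Icc (0 : ℝ) (1 / 2) := ((exists_inv hγ x).choose_spec hx).1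

lemma lsv_linv {γ x : ℝ} (hγ : 0 < γ) (hx : x ∈ Icc (0 : ℝ) 1) :
    lsv γ (linv hγ x) = x := ((exists_inv hγ x).choose_spec hx).2

lemma linv_mono {γ x x' : ℝ} (hγ : 0 < γ) (hγ1 : γ ≤ 1) (hx : x ∈ Icc (0 : ℝ) 1)
    (hx' : x' ∈ Icc (0 : ℝ) 1) (h : x ≤ x') : linv hγ x ≤ linv hγ x' := by
  rw [← (lsv_strictMonoOn hγ hγ1).le_iff_le (linv_mem hγ hx) (linv_mem hγ hx'), lsv_linv hγ hx,
    lsv_linv hγ hx']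
  exact h

lemma linv_concaveOn {γ : ℝ} (hγ : 0 < γ) (hγ1 : γ ≤ 1) :
    ConcaveOn ℝ (Icc 0 1) (linv hγ) := by
  refine ⟨convex_Icc _ _, fun x hx y hy a b ha hb hab => ?_⟩
  have hxy := convex_Icc (0:ℝ) 1 hx hy ha hb hab
  have hm := convex_Icc (0:ℝ) (1/2) (linv_mem hγ hx) (linv_mem hγ hy) ha hb hab
  rw [← (lsv_strictMonoOn hγ hγ1).le_iff_le hm (linv_mem hγ hxy), lsv_linv hγ hxy]
  have := (lsv_convexOn hγ).2 (linv_mem hγ hx) (linv_mem hγ hy) ha hb hab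
  rwa [lsv_linv hγ hx, lsv_linv hγ hy] at this

/-! ### Measures on the line with concave distribution function -/

/-- finite measures on `(0,1]` with concave distribution function -/
structure Good (μ : Measure ℝ) : Prop where
  fin : IsFiniteMeasure μ
  zero : μ (Iic 0) = 0
  one : μ (Ioi 1) = 0
  conc : ConcaveOn ℝ (Icc 0 1) (fun x => μ.real (Iic x))

/-- pushforward of the part on the left branch -/
def pushL (γ : ℝ) (μ : Measure ℝ) : Measure ℝ := (μ.restrict (Iic (1 / 2))).map (lsv γ)

/-- pushforward of the part on the right branch -/
def pushR (γ : ℝ) (μ : Measure ℝ) : Measure ℝ := (μ.restrict (Ioi (1 / 2))).map (lsv γ)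

lemma pushL_Iic {γ x : ℝ} (hγ : 0 < γ) (hγ1 : γ ≤ 1) {μ : Measure ℝ} (h0 : μ (Iic 0) = 0)
    (hx : x ∈ Icc (0 : ℝ) 1) : pushL γ μ (Iic x) = μ (Iic (linv hγ x)) := by
  rw [pushL, Measure.map_apply (measurable_lsv γ) measurableSet_Iic,
    Measure.restrict_apply (measurable_lsv γ measurableSet_Iic)]
  apply measure_congr
  have : ∀ᵐ z ∂μ, z ∉ Iic (0:ℝ) := measure_eq_zero_iff_ae_notMem.mp h0
  filter_upwards [this] with z hz
  simp only [mem_Iic, not_le] at hz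
  apply propext
  change (lsv γ z ≤ x ∧ z ≤ 1 / 2) ↔ z ≤ linv hγ x
  have hl := linv_mem hγ hx
  constructor
  · rintro ⟨h1, h2⟩
    rw [← (lsv_strictMonoOn hγ hγ1).le_iff_le ⟨hz.le, h2⟩ hl, lsv_linv hγ hx]
    exact h1
  · intro h
    have h2 := h.trans hl.2
    rw [← (lsv_strictMonoOn hγ hγ1).le_iff_le ⟨hz.le, h2⟩ hl, lsv_linv hγ hx] at h
    exact ⟨h, h2⟩

lemma pushR_Iic {γ x : ℝ} {μ : Measure ℝ} (hx : 0 ≤ x) :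
    pushR γ μ (Iic x) = μ (Ioc (1 / 2) ((1 + x) / 2)) := by
  rw [pushR, Measure.map_apply (measurable_lsv γ) measurableSet_Iic,
    Measure.restrict_apply (measurable_lsv γ measurableSet_Iic)]
  congr 1
  ext z
  simp only [mem_inter_iff, mem_preimage, mem_Iic, mem_Ioi, mem_Ioc]
  constructor
  · rintro ⟨h1, h2⟩
    rw [lsv_right h2] at h1
    exact ⟨h2, by linarith⟩
  · rintro ⟨h1, h2⟩
    rw [lsv_right h1]
    exact ⟨by linarith, h1⟩

lemma real_Ioc {μ : Measure ℝ} [IsFiniteMeasure μ] {a b : ℝ} (h : a ≤ b) :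
    μ.real (Ioc a b) = μ.real (Iic b) - μ.real (Iic a) := by
  rw [← Iic_sdiff_Iic, measureReal_sdiff (Iic_subset_Iic.mpr h) measurableSet_Iic]

lemma pushR_real {γ x : ℝ} {μ : Measure ℝ} [IsFiniteMeasure μ] (hx : 0 ≤ x) :
    (pushR γ μ).real (Iic x) = μ.real (Iic ((1 + x) / 2)) - μ.real (Iic (1 / 2)) := by
  rw [← real_Ioc (by linarith), measureReal_def, pushR_Iic hx, ← measureReal_def]

lemma pushL_real {γ x : ℝ} (hγ : 0 < γ) (hγ1 : γ ≤ 1) {μ : Measure ℝ} (h0 : μ (Iic 0) = 0)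
    (hx : x ∈ Icc (0 : ℝ) 1) : (pushL γ μ).real (Iic x) = μ.real (Iic (linv hγ x)) := by
  rw [measureReal_def, pushL_Iic hγ hγ1 h0 hx, ← measureReal_def]

lemma cdf_mono (μ : Measure ℝ) [IsFiniteMeasure μ] : Monotone (fun x => μ.real (Iic x)) :=
  fun _ _ h => measureReal_mono (Iic_subset_Iic.mpr h)

lemma linv_zero {γ : ℝ} (hγ : 0 < γ) (hγ1 : γ ≤ 1) : linv hγ 0 = 0 := by
  have h0 : (0:ℝ) ∈ Icc (0:ℝ) 1 := by simp
  apply (lsv_strictMonoOn hγ hγ1).injOn (linv_mem hγ h0) (by simp)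
  rw [lsv_linv hγ h0, lsv_zero]

lemma good_pushL {γ : ℝ} (hγ : 0 < γ) (hγ1 : γ ≤ 1) {μ : Measure ℝ} (h : Good μ) :
    Good (pushL γ μ) := by
  have := h.fin
  refine ⟨by unfold pushL; infer_instance, ?_, ?_, ?_⟩
  · rw [pushL_Iic hγ hγ1 h.zero (by simp), linv_zero hγ hγ1, h.zero]
  · rw [pushL, Measure.map_apply (measurable_lsv γ) measurableSet_Ioi,
      Measure.restrict_apply (measurable_lsv γ measurableSet_Ioi)]
    refine measure_mono_null ?_ h.zero
    rintro z ⟨h1, h2⟩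
    by_contra h3
    simp only [mem_preimage, mem_Ioi, mem_Iic, not_le] at h1 h2 h3
    have := (lsv_strictMonoOn hγ hγ1).monotoneOn ⟨h3.le, h2⟩ (by norm_num : (1/2:ℝ) ∈ Icc (0:ℝ) (1/2)) h2
    rw [lsv_half] at this
    linarith
  · refine ⟨convex_Icc _ _, fun x hx y hy a b ha hb hab => ?_⟩
    have hxy := convex_Icc (0:ℝ) 1 hx hy ha hb hab
    have hs : ∀ {t : ℝ}, t ∈ Icc (0:ℝ) (1/2) → t ∈ Icc (0:ℝ) 1 :=
      fun ht => ⟨ht.1, ht.2.trans (by norm_num)⟩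
    simp only
    rw [pushL_real hγ hγ1 h.zero hx, pushL_real hγ hγ1 h.zero hy, pushL_real hγ hγ1 h.zero hxy]
    refine (h.conc.2 (hs (linv_mem hγ hx)) (hs (linv_mem hγ hy)) ha hb hab).trans ?_
    exact cdf_mono μ ((linv_concaveOn hγ hγ1).2 hx hy ha hb hab)

lemma good_pushR {γ : ℝ} {μ : Measure ℝ} (h : Good μ) : Good (pushR γ μ) := by
  have := h.fin
  refine ⟨by unfold pushR; infer_instance, ?_, ?_, ?_⟩
  · rw [pushR_Iic le_rfl]; simp
  · rw [pushR, Measure.map_apply (measurable_lsv γ) measurableSet_Ioi,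
      Measure.restrict_apply (measurable_lsv γ measurableSet_Ioi)]
    refine measure_mono_null ?_ h.one
    rintro z ⟨h1, h2⟩
    simp only [mem_preimage, mem_Ioi] at h1 h2 ⊢
    rw [lsv_right h2] at h1
    linarith
  · refine ⟨convex_Icc _ _, fun x hx y hy a b ha hb hab => ?_⟩
    have hxy := convex_Icc (0:ℝ) 1 hx hy ha hb hab
    have hs : ∀ {t : ℝ}, t ∈ Icc (0:ℝ) 1 → (1 + t) / 2 ∈ Icc (0:ℝ) 1 :=
      fun ht => ⟨by linarith [ht.1], by linarith [ht.2]⟩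
    simp only
    rw [pushR_real hx.1, pushR_real hy.1, pushR_real hxy.1]
    have := h.conc.2 (hs hx) (hs hy) ha hb hab
    simp only [smul_eq_mul] at this ⊢
    have e : (1 + (a * x + b * y)) / 2 = a * ((1 + x) / 2) + b * ((1 + y) / 2) := by
      have : b = 1 - a := by linarith
      subst this; ring
    rw [e]
    have e2 : μ.real (Iic (1/2)) = a * μ.real (Iic (1/2)) + b * μ.real (Iic (1/2)) := by
      rw [← add_mul, hab, one_mul]
    linarith

lemma good_add {μ ν : Measure ℝ} (h : Good μ) (h' : Good ν) : Good (μ + ν) := by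
  have := h.fin
  have := h'.fin
  refine ⟨inferInstance, by simp [h.zero, h'.zero], by simp [h.one, h'.one], ?_⟩
  refine (h.conc.add h'.conc).congr (fun x _ => ?_)
  simp [measureReal_add_apply]

lemma good_smul {μ : Measure ℝ} (h : Good μ) {c : ℝ} : Good (ENNReal.ofReal c • μ) := by
  have := h.fin
  refine ⟨Measure.smul_finite _ (by simp), by simp [h.zero], by simp [h.one], ?_⟩
  refine (h.conc.smul (ENNReal.toReal_nonneg (a := ENNReal.ofReal c))).congr (fun x _ => ?_)
  simp [measureReal_ennreal_smul_apply]

/-- Comparison of finite measures on half-open intervals. -/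
lemma le_of_Ioc {μ ν : Measure ℝ} [IsFiniteMeasure μ] [IsFiniteMeasure ν]
    (h : ∀ a b, a < b → μ.real (Ioc a b) ≤ ν.real (Ioc a b)) : μ ≤ ν := by
  have hc : ∀ (κ : Measure ℝ) [IsFiniteMeasure κ] (x : ℝ),
      ContinuousWithinAt (fun x => κ.real (Iic x)) (Ici x) x := by
    intro κ _ x
    rw [← continuousWithinAt_Ioi_iff_Ici]
    have h1 : Tendsto (fun y => κ (Iic y)) (nhdsWithin x (Ioi x)) (nhds (κ (⋂ r > x, Iic r))) := by
      refine tendsto_measure_biInter_gt (fun r _ => measurableSet_Iic.nullMeasurableSet)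
        (fun i j _ hij => Iic_subset_Iic.mpr hij) ⟨x + 1, by simp, measure_ne_top _ _⟩
    have h2 : (⋂ r > x, Iic r) = Iic x := by
      ext z
      simp only [mem_iInter, mem_Iic]
      exact ⟨fun H => le_of_forall_gt_imp_ge_of_dense H, fun H r hr => H.trans hr.le⟩
    rw [h2] at h1
    exact (ENNReal.tendsto_toReal (measure_ne_top _ _)).comp h1
  let f : StieltjesFunction ℝ :=
    { toFun := fun x => ν.real (Iic x) - μ.real (Iic x)
      mono' := by
        intro a b hab
        rcases hab.eq_or_lt with rfl | hab
        · rfl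
        · have := h a b hab
          rw [real_Ioc hab.le, real_Ioc hab.le] at this
          simp only
          linarith
      right_continuous' := fun x => (hc ν x).sub (hc μ x) }
  have : ν = μ + f.measure := by
    refine Measure.ext_of_Ioc _ _ (fun a b hab => ?_)
    have e : f.measure (Ioc a b) = ENNReal.ofReal (ν.real (Ioc a b) - μ.real (Ioc a b)) := by
      rw [StieltjesFunction.measure_Ioc, real_Ioc hab.le, real_Ioc hab.le]
      congr 1
      change (ν.real (Iic b) - μ.real (Iic b)) - (ν.real (Iic a) - μ.real (Iic a)) = _
      ring
    rw [Measure.add_apply, e, ← ofReal_measureReal (μ := μ), ← ofReal_measureReal (μ := ν),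
      ← ENNReal.ofReal_add measureReal_nonneg (by linarith [h a b hab])]
    congr 1
    ring
  rw [this]
  exact Measure.le_add_right le_rfl

lemma conc_slope {F : ℝ → ℝ} (hF : ConcaveOn ℝ (Icc 0 1) F) {a b c d : ℝ} (h0 : 0 ≤ a)
    (hab : a < b) (hbc : b ≤ c) (hcd : c < d) (hd : d ≤ 1) :
    (F d - F c) / (d - c) ≤ (F b - F a) / (b - a) := by
  rcases hbc.eq_or_lt with rfl | hbc
  · exact hF.slope_anti_adjacent ⟨h0, by linarith⟩ ⟨by linarith, hd⟩ hab hcd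
  · exact (hF.slope_anti_adjacent ⟨by linarith, by linarith⟩ ⟨by linarith, hd⟩ hbc hcd).trans
      (hF.slope_anti_adjacent ⟨h0, by linarith⟩ ⟨by linarith, by linarith⟩ hab hbc)

lemma good_minor {μ : Measure ℝ} (h : Good μ) {x₀ x₁ : ℝ} (h0 : 0 < x₀) (h01 : x₀ < x₁)
    (h1 : x₁ ≤ 1) : ENNReal.ofReal (μ.real (Ioc x₀ x₁) / (x₁ - x₀)) • volume.restrict (Ioc 0 x₀)
      ≤ μ := by
  have := h.fin
  set c := μ.real (Ioc x₀ x₁) / (x₁ - x₀) with hcdef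
  have hc0 : 0 ≤ c := div_nonneg measureReal_nonneg (by linarith)
  have : IsFiniteMeasure (ENNReal.ofReal c • volume.restrict (Ioc 0 x₀)) :=
    Measure.smul_finite _ (by simp)
  refine le_of_Ioc (fun a b hab => ?_)
  rw [measureReal_ennreal_smul_apply, ENNReal.toReal_ofReal hc0,
    measureReal_restrict_apply measurableSet_Ioc, Ioc_inter_Ioc]
  rcases lt_or_ge (max a 0) (min b x₀) with hm | hm
  · have e : μ.real (Ioc (max a 0) (min b x₀)) ≤ μ.real (Ioc a b) :=
      measureReal_mono (Ioc_subset_Ioc (le_max_left _ _) (min_le_left _ _))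
    refine le_trans ?_ e
    have := conc_slope h.conc (le_max_right a 0) hm (min_le_right b x₀) h01 h1
    rw [← real_Ioc h01.le, ← real_Ioc hm.le, ← hcdef, le_div_iff₀ (by linarith)] at this
    rw [Real.volume_real_Ioc_of_le hm.le]
    exact this
  · rw [Ioc_eq_empty (not_lt.mpr hm)]
    simp

/-- Lebesgue measure on the unit interval. -/
def lam : Measure ℝ := volume.restrict (Icc 0 1)

instance : IsProbabilityMeasure lam := ⟨by simp [lam]⟩

lemma lam_Iic {x : ℝ} (hx : x ∈ Icc (0:ℝ) 1) : lam.real (Iic x) = x := by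
  rw [lam, measureReal_restrict_apply measurableSet_Iic]
  have : Iic x ∩ Icc 0 1 = Icc 0 x := by
    ext z
    simp only [mem_inter_iff, mem_Iic, mem_Icc]
    exact ⟨fun h => ⟨h.2.1, h.1⟩, fun h => ⟨h.2, h.1, h.2.trans hx.2⟩⟩
  rw [this, Real.volume_real_Icc_of_le hx.1, sub_zero]

lemma good_lam : Good lam := by
  refine ⟨inferInstance, ?_, ?_, ?_⟩
  · have := lam_Iic (x := 0) (by simp)
    rw [measureReal_def, ENNReal.toReal_eq_zero_iff] at this
    exact this.resolve_right (measure_ne_top _ _)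
  · rw [lam, Measure.restrict_apply measurableSet_Ioi]
    have : Ioi (1:ℝ) ∩ Icc 0 1 = ∅ := by
      ext z; simp only [mem_inter_iff, mem_Ioi, mem_Icc, mem_empty_iff_false, iff_false]
      intro h; linarith [h.1, h.2.2]
    rw [this, measure_empty]
  · exact (concaveOn_id (convex_Icc 0 1)).congr (fun x hx => (lam_Iic hx).symm)

end SkewAcip

namespace SkewAcip

/-! ### Branches of the skew product and cylinder sets -/

/-- The four branch domains. -/
def Q (p₁ : ℝ) (b : Bool × Bool) : Set (ℝ × ℝ) :=
  (if b.1 then Iic (1 / 2) else Ioi (1 / 2)) ×ˢ (if b.2 then Iio p₁ else Ici p₁)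

/-- Cylinder sets. -/
def cyl (α β p₁ p₂ : ℝ) (n : ℕ) (c : Fin n → Bool × Bool) : Set (ℝ × ℝ) :=
  {z | ∀ i : Fin n, (skew α β p₁ p₂)^[i] z ∈ Q p₁ (c i)}

lemma measurableSet_Q (p₁ : ℝ) (b : Bool × Bool) : MeasurableSet (Q p₁ b) := by
  unfold Q
  apply MeasurableSet.prod
  · split_ifs; exacts [measurableSet_Iic, measurableSet_Ioi]
  · split_ifs; exacts [measurableSet_Iio, measurableSet_Ici]

lemma Q_disj {p₁ : ℝ} {b b' : Bool × Bool} {z : ℝ × ℝ} (h : z ∈ Q p₁ b) (h' : z ∈ Q p₁ b') :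
    b = b' := by
  obtain ⟨b1, b2⟩ := b
  obtain ⟨c1, c2⟩ := b'
  cases b1 <;> cases b2 <;> cases c1 <;> cases c2 <;> simp [Q] at h h' ⊢ <;> linarith [h.1, h.2, h'.1, h'.2]

lemma Q_cover (p₁ : ℝ) (z : ℝ × ℝ) : ∃ b, z ∈ Q p₁ b := by
  rcases le_or_gt z.1 (1/2) with h1 | h1 <;> rcases lt_or_ge z.2 p₁ with h2 | h2
  · exact ⟨(true, true), ⟨by simpa using h1, by simpa using h2⟩⟩
  · exact ⟨(true, false), ⟨by simpa using h1, by simpa using h2⟩⟩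
  · exact ⟨(false, true), ⟨by simpa using h1, by simpa using h2⟩⟩
  · exact ⟨(false, false), ⟨by simpa using h1, by simpa using h2⟩⟩

lemma cyl_succ (α β p₁ p₂ : ℝ) (n : ℕ) (c : Fin (n + 1) → Bool × Bool) :
    cyl α β p₁ p₂ (n + 1) c =
      (skew α β p₁ p₂) ⁻¹' (cyl α β p₁ p₂ n (Fin.tail c)) ∩ Q p₁ (c 0) := by
  ext z
  simp only [cyl, mem_ofPred_eq, Fin.forall_fin_succ, mem_inter_iff, mem_preimage, Fin.val_zero,
    Function.iterate_zero, id, Fin.val_succ, Function.iterate_succ, Function.comp, Fin.tail]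
  tauto

lemma measurableSet_cyl (α β p₁ p₂ : ℝ) (n : ℕ) (c : Fin n → Bool × Bool) :
    MeasurableSet (cyl α β p₁ p₂ n c) := by
  have : cyl α β p₁ p₂ n c = ⋂ i : Fin n, (skew α β p₁ p₂)^[i] ⁻¹' Q p₁ (c i) := by
    ext z; simp [cyl]
  rw [this]
  exact MeasurableSet.iInter fun i => (measurable_skew α β p₁ p₂).iterate i (measurableSet_Q _ _)

lemma cyl_disj (α β p₁ p₂ : ℝ) (n : ℕ) : Pairwise (Function.onFun Disjoint (cyl α β p₁ p₂ n)) := by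
  intro c c' h
  refine Set.disjoint_left.mpr (fun z hz hz' => h ?_)
  funext i
  exact Q_disj (hz i) (hz' i)

lemma cyl_cover (α β p₁ p₂ : ℝ) (n : ℕ) : ⋃ c, cyl α β p₁ p₂ n c = univ := by
  refine eq_univ_of_forall (fun z => ?_)
  choose f hf using Q_cover p₁
  exact mem_iUnion.mpr ⟨fun i => f ((skew α β p₁ p₂)^[i] z), fun i => hf _⟩

/-! ### The base map -/

lemma map_affine {a p : ℝ} (hp : 0 < p) :
    (volume : Measure ℝ).map (fun ω => (ω - a) / p) = ENNReal.ofReal p • volume := by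
  have h1 : (fun ω : ℝ => (ω - a) / p) = (fun x => p⁻¹ * x) ∘ (fun ω => ω - a) := by
    funext ω; simp [div_eq_inv_mul]
  rw [h1, ← Measure.map_map (by fun_prop) (by fun_prop), map_sub_right_eq_self,
    Real.map_volume_mul_left (inv_ne_zero hp.ne'), inv_inv, abs_of_pos hp]

lemma map_restrict_affine {a p : ℝ} (hp : 0 < p) :
    ((volume : Measure ℝ).restrict (Icc a (a + p))).map (fun ω => (ω - a) / p)
      = ENNReal.ofReal p • lam := by
  have h : Icc a (a + p) = (fun ω => (ω - a) / p) ⁻¹' (Icc 0 1) := by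
    ext x
    simp only [mem_Icc, mem_preimage, le_div_iff₀ hp, div_le_iff₀ hp]
    constructor <;> rintro ⟨h1, h2⟩ <;> constructor <;> linarith
  rw [h, ← Measure.restrict_map (by fun_prop) measurableSet_Icc, map_affine hp,
    Measure.restrict_smul]
  rfl

lemma phi_left {p₁ p₂ : ℝ} (hp₁ : 0 < p₁) (hp₂ : 0 < p₂) (hp : p₁ + p₂ = 1) :
    (lam.restrict (Iio p₁)).map (phiMap p₁ p₂) = ENNReal.ofReal p₁ • lam := by
  rw [← map_restrict_affine (a := 0) hp₁]
  have e : lam.restrict (Iio p₁) = volume.restrict (Icc 0 (0 + p₁)) := by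
    rw [lam, Measure.restrict_restrict measurableSet_Iio]
    have : Iio p₁ ∩ Icc 0 1 = Ico 0 p₁ := by
      ext x; simp only [mem_inter_iff, mem_Iio, mem_Icc, mem_Ico]
      constructor
      · rintro ⟨h1, h2, h3⟩; exact ⟨h2, h1⟩
      · rintro ⟨h1, h2⟩; exact ⟨h2, h1, by linarith⟩
    rw [this, zero_add]
    exact Measure.restrict_congr_set Ico_ae_eq_Icc
  rw [← e]
  apply Measure.map_congr
  filter_upwards [ae_restrict_mem measurableSet_Iio] with x hx
  simp only [mem_Iio] at hx
  simp [phiMap, hx]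

lemma phi_right {p₁ p₂ : ℝ} (hp₁ : 0 < p₁) (hp₂ : 0 < p₂) (hp : p₁ + p₂ = 1) :
    (lam.restrict (Ici p₁)).map (phiMap p₁ p₂) = ENNReal.ofReal p₂ • lam := by
  rw [← map_restrict_affine (a := p₁) hp₂]
  have e : lam.restrict (Ici p₁) = volume.restrict (Icc p₁ (p₁ + p₂)) := by
    rw [lam, Measure.restrict_restrict measurableSet_Ici, hp]
    congr 1
    ext x; simp only [mem_inter_iff, mem_Ici, mem_Icc]
    constructor
    · rintro ⟨h1, h2, h3⟩; exact ⟨h1, h3⟩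
    · rintro ⟨h1, h2⟩; exact ⟨h1, by linarith, h2⟩
  rw [← e]
  apply Measure.map_congr
  filter_upwards [ae_restrict_mem measurableSet_Ici] with x hx
  simp only [mem_Ici] at hx
  simp [phiMap, not_lt.mpr hx]

/-! ### The class of product measures with decreasing density -/

/-- products of good measures with Lebesgue measure -/
def DD (m : Measure (ℝ × ℝ)) : Prop := ∃ μ, Good μ ∧ m = μ.prod lam

lemma push_quarter (α β : ℝ) {p₁ p₂ : ℝ} (hp₁ : 0 < p₁) (hp₂ : 0 < p₂) (hp : p₁ + p₂ = 1)
    (μ : Measure ℝ) [IsFiniteMeasure μ] (b : Bool × Bool) :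
    ((μ.prod lam).restrict (Q p₁ b)).map (skew α β p₁ p₂) =
      (ENNReal.ofReal (if b.2 then p₁ else p₂) • (if b.1 then pushL (if b.2 then α else β) μ
        else pushR (if b.2 then α else β) μ)).prod lam := by
  have h1 : ((μ.prod lam).restrict (Q p₁ b)).map (skew α β p₁ p₂) =
      ((μ.prod lam).restrict (Q p₁ b)).map
        (Prod.map (lsv (if b.2 then α else β)) (phiMap p₁ p₂)) := by
    apply Measure.map_congr
    filter_upwards [ae_restrict_mem (measurableSet_Q p₁ b)] with z hz
    have h2 := hz.2
    simp only [skew, sel, Prod.map]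
    congr 2
    split_ifs with h3 h4 h4
    · rfl
    · simp [h4] at h2; linarith
    · simp [h4] at h2; linarith
    · rfl
  rw [h1, Q, ← Measure.prod_restrict, ← Measure.map_prod_map _ _ (measurable_lsv _)
    (measurable_phi _ _)]
  have h2 : (lam.restrict (if b.2 then Iio p₁ else Ici p₁)).map (phiMap p₁ p₂) =
      ENNReal.ofReal (if b.2 then p₁ else p₂) • lam := by
    split_ifs
    · exact phi_left hp₁ hp₂ hp
    · exact phi_right hp₁ hp₂ hp
  rw [h2, Measure.prod_smul_right, ← Measure.prod_smul_left]
  congr 2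
  split_ifs <;> rfl

lemma DD_step {α β p₁ p₂ : ℝ} (hα : 0 < α) (hαβ : α < β) (hβ : β ≤ 1)
    (hp₁ : 0 < p₁) (hp₂ : 0 < p₂) (hp : p₁ + p₂ = 1) {m : Measure (ℝ × ℝ)} (hm : DD m)
    (b : Bool × Bool) : DD ((m.restrict (Q p₁ b)).map (skew α β p₁ p₂)) := by
  obtain ⟨μ, hμ, rfl⟩ := hm
  have := hμ.fin
  refine ⟨_, ?_, push_quarter α β hp₁ hp₂ hp μ b⟩
  apply good_smul
  split_ifs
  · exact good_pushL hα (by linarith) hμ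
  · exact good_pushL (by linarith) hβ hμ
  · exact good_pushR hμ
  · exact good_pushR hμ

lemma DD_cyl {α β p₁ p₂ : ℝ} (hα : 0 < α) (hαβ : α < β) (hβ : β ≤ 1)
    (hp₁ : 0 < p₁) (hp₂ : 0 < p₂) (hp : p₁ + p₂ = 1) (n : ℕ) : ∀ (c : Fin n → Bool × Bool)
    {m : Measure (ℝ × ℝ)} (_ : DD m),
    DD ((m.restrict (cyl α β p₁ p₂ n c)).map (skew α β p₁ p₂)^[n]) := by
  induction n with
  | zero =>
    intro c m hm
    have : cyl α β p₁ p₂ 0 c = univ := by ext z; simp [cyl]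
    rw [this]
    simpa using hm
  | succ n ih =>
    intro c m hm
    have hS := measurable_skew α β p₁ p₂
    rw [cyl_succ, Function.iterate_succ, ← Measure.map_map (hS.iterate n) hS,
      ← Measure.restrict_restrict (hS (measurableSet_cyl _ _ _ _ _ _)),
      ← Measure.restrict_map hS (measurableSet_cyl _ _ _ _ _ _)]
    exact ih _ (DD_step hα hαβ hβ hp₁ hp₂ hp hm _)

/-! ### Cylinders are small -/

lemma lsv_mem {γ x : ℝ} (hγ : 0 < γ) (hγ1 : γ ≤ 1) (hx : x ∈ Icc (0:ℝ) 1) :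
    lsv γ x ∈ Icc (0:ℝ) 1 := by
  rcases le_or_gt x (1/2) with h | h
  · have hm := (lsv_strictMonoOn hγ hγ1).monotoneOn
    have h1 := hm (by norm_num) ⟨hx.1, h⟩ hx.1
    have h2 := hm ⟨hx.1, h⟩ (by norm_num) h
    rw [lsv_zero] at h1
    rw [lsv_half] at h2
    exact ⟨h1, h2⟩
  · rw [lsv_right h]
    exact ⟨by linarith, by linarith [hx.2]⟩

lemma phi_mem {p₁ p₂ ω : ℝ} (hp₁ : 0 < p₁) (hp₂ : 0 < p₂) (hp : p₁ + p₂ = 1)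
    (hω : ω ∈ Icc (0:ℝ) 1) : phiMap p₁ p₂ ω ∈ Icc (0:ℝ) 1 := by
  unfold phiMap
  split_ifs with h
  · exact ⟨div_nonneg hω.1 hp₁.le, (div_le_one hp₁).mpr h.le⟩
  · exact ⟨div_nonneg (by linarith) hp₂.le, (div_le_one hp₂).mpr (by linarith [hω.2])⟩

/-- the unit square -/
def sq : Set (ℝ × ℝ) := Icc (0:ℝ) 1 ×ˢ Icc (0:ℝ) 1

lemma skew_mem {α β p₁ p₂ : ℝ} (hα : 0 < α) (hαβ : α < β) (hβ : β ≤ 1)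
    (hp₁ : 0 < p₁) (hp₂ : 0 < p₂) (hp : p₁ + p₂ = 1) {z : ℝ × ℝ} (hz : z ∈ sq) :
    skew α β p₁ p₂ z ∈ sq := by
  refine ⟨?_, phi_mem hp₁ hp₂ hp hz.2⟩
  simp only [skew, sel]
  split_ifs
  · exact lsv_mem hα (by linarith) hz.1
  · exact lsv_mem (by linarith) hβ hz.1

lemma contract_step {γ x y e : ℝ} (hγ : 0 < γ) (hγ1 : γ ≤ 1) (hx : x ∈ Icc (0:ℝ) 1)
    (hy : y ∈ Icc (0:ℝ) 1) (hxy : (x ≤ 1/2 ∧ y ≤ 1/2) ∨ (1/2 < x ∧ 1/2 < y))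
    (h : |lsv γ x - lsv γ y| ≤ e) : |x - y| * (1 + 2 * |x - y|) ≤ e := by
  wlog hle : y ≤ x generalizing x y
  · rw [abs_sub_comm x y]
    exact this hy hx (by tauto) (by rwa [abs_sub_comm]) (le_of_not_ge hle)
  rw [abs_of_nonneg (sub_nonneg.mpr hle)]
  refine le_trans ?_ ((le_abs_self _).trans h)
  rcases hxy with ⟨h1, h2⟩ | ⟨h1, h2⟩
  · exact lsv_expand hγ hγ1 hy.1 hle h1
  · rw [lsv_right h1, lsv_right h2]
    nlinarith [hx.2, sub_nonneg.mpr hle]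

lemma contract_arith {d e : ℝ} (n : ℕ) (hd : 0 ≤ d) (h : d * (1 + 2 * d) ≤ e)
    (he : e ≤ 1 / ((n:ℝ) + 1)) : d ≤ 1 / ((n:ℝ) + 2) := by
  by_contra hc
  rw [not_le, div_lt_iff₀ (by positivity)] at hc
  have h1 := h.trans he
  rw [le_div_iff₀ (by positivity)] at h1
  have hn : (0:ℝ) ≤ n := Nat.cast_nonneg n
  have h2 : 0 < d := by nlinarith
  nlinarith [mul_pos h2 (sub_pos.mpr hc), mul_nonneg h2.le hn]

lemma cyl_small {α β p₁ p₂ : ℝ} (hα : 0 < α) (hαβ : α < β) (hβ : β ≤ 1)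
    (hp₁ : 0 < p₁) (hp₂ : 0 < p₂) (hp : p₁ + p₂ = 1) (n : ℕ) : ∀ (c : Fin n → Bool × Bool)
    (z w : ℝ × ℝ), z ∈ sq → w ∈ sq → z ∈ cyl α β p₁ p₂ n c → w ∈ cyl α β p₁ p₂ n c →
    |z.1 - w.1| ≤ 1 / ((n:ℝ) + 1) ∧ |z.2 - w.2| ≤ (max p₁ p₂) ^ n := by
  induction n with
  | zero =>
    intro c z w hz hw _ _
    simp only [Nat.cast_zero, zero_add, div_one, pow_zero, abs_le]
    have := hz.1; have := hz.2; have := hw.1; have := hw.2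
    simp only [mem_Icc] at *
    refine ⟨⟨?_, ?_⟩, ?_, ?_⟩ <;> linarith
  | succ n ih =>
    intro c z w hz hw hzc hwc
    rw [cyl_succ] at hzc hwc
    obtain ⟨ih1, ih2⟩ := ih _ _ _ (skew_mem hα hαβ hβ hp₁ hp₂ hp hz)
      (skew_mem hα hαβ hβ hp₁ hp₂ hp hw) hzc.1 hwc.1
    have hzq := hzc.2
    have hwq := hwc.2
    simp only [Q, mem_prod] at hzq hwq
    constructor
    · have hsel : sel α β p₁ z.2 = sel α β p₁ w.2 := by
        have h1 := hzq.2
        have h2 := hwq.2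
        split_ifs at h1 h2 with hb
        · simp only [mem_Iio] at h1 h2
          simp [sel, h1, h2]
        · simp only [mem_Ici] at h1 h2
          simp [sel, not_lt.mpr h1, not_lt.mpr h2]
      have hγ : 0 < sel α β p₁ w.2 ∧ sel α β p₁ w.2 ≤ 1 := by
        unfold sel; split_ifs <;> constructor <;> linarith
      simp only [skew] at ih1
      rw [hsel] at ih1
      have h3 : (z.1 ≤ 1/2 ∧ w.1 ≤ 1/2) ∨ (1/2 < z.1 ∧ 1/2 < w.1) := by
        have h1 := hzq.1
        have h2 := hwq.1
        split_ifs at h1 h2 with hb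
        · exact Or.inl ⟨h1, h2⟩
        · exact Or.inr ⟨h1, h2⟩
      have h4 := contract_step hγ.1 hγ.2 hz.1 hw.1 h3 ih1
      have h5 := contract_arith n (abs_nonneg _) h4 le_rfl
      push_cast
      rw [add_assoc]
      norm_num at h5 ⊢
      exact h5
    · simp only [skew, phiMap] at ih2
      have h1 := hzq.2
      have h2 := hwq.2
      have hP : 0 ≤ (max p₁ p₂) ^ n := pow_nonneg (hp₁.le.trans (le_max_left _ _)) n
      rw [pow_succ]
      split_ifs at h1 h2 with hb
      · simp only [mem_Iio] at h1 h2
        rw [if_pos h1, if_pos h2, ← sub_div, abs_div, abs_of_pos hp₁, div_le_iff₀ hp₁] at ih2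
        exact ih2.trans (mul_le_mul_of_nonneg_left (le_max_left _ _) hP)
      · simp only [mem_Ici] at h1 h2
        rw [if_neg (not_lt.mpr h1), if_neg (not_lt.mpr h2), ← sub_div, abs_div, abs_of_pos hp₂,
          div_le_iff₀ hp₂, sub_sub_sub_cancel_right] at ih2
        exact ih2.trans (mul_le_mul_of_nonneg_left (le_max_right _ _) hP)

end SkewAcip

namespace SkewAcip

/-! ### Uniqueness -/

/-- Lebesgue measure on the square -/
def LL : Measure (ℝ × ℝ) := lam.prod lam

lemma LL_eq : LL = volume.restrict (Icc (0 : ℝ) 1 ×ˢ Icc (0 : ℝ) 1) := by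
  rw [LL, lam, Measure.prod_restrict, Measure.volume_eq_prod]

instance : IsProbabilityMeasure LL := by unfold LL; infer_instance

instance : LL.Regular := by
  rw [LL_eq]
  have : (volume.restrict (Icc (0 : ℝ) 1 ×ˢ Icc (0 : ℝ) 1) : Measure (ℝ × ℝ)) (univ) < ⊤ := by
    rw [← LL_eq]; exact measure_lt_top _ _
  infer_instance

lemma DD_LL : DD LL := ⟨lam, good_lam, rfl⟩

lemma ae_sq : ∀ᵐ z ∂LL, z ∈ sq := by
  rw [LL_eq]
  exact ae_restrict_mem (measurableSet_Icc.prod measurableSet_Icc)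

lemma core {α β p₁ p₂ : ℝ} (hα : 0 < α) (hαβ : α < β) (hβ : β ≤ 1)
    (hp₁ : 0 < p₁) (hp₂ : 0 < p₂) (hp : p₁ + p₂ = 1) {k : ℝ × ℝ → ℝ} (hk : Measurable k)
    (hk1 : ∀ z, |k z| ≤ 1) (hkD : ∀ m, DD m → 0 ≤ ∫ z, k z ∂m) {ν : Measure (ℝ × ℝ)}
    [IsProbabilityMeasure ν] (hac : ν ≪ LL)
    (hinv : MeasurePreserving (skew α β p₁ p₂) ν ν) : 0 ≤ ∫ z, k z ∂ν := by
  have hS := measurable_skew α β p₁ p₂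
  set S := skew α β p₁ p₂ with hSdef
  refine le_of_forall_pos_le_add (fun ε' hε' => ?_)
  obtain ⟨ε, hε, rfl⟩ : ∃ ε > 0, ε' = 2 * ε := ⟨ε' / 2, by positivity, by ring⟩
  set f : ℝ × ℝ → ℝ := fun z => (ν.rnDeriv LL z).toReal with hf
  have hfi : Integrable f LL := Measure.integrable_toReal_rnDeriv
  have hf0 : ∀ z, 0 ≤ f z := fun z => ENNReal.toReal_nonneg
  obtain ⟨g, -, hg1, hgc, hgi⟩ := hfi.exists_hasCompactSupport_integral_sub_le hε
  have hK : IsCompact sq := isCompact_Icc.prod isCompact_Icc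
  have huc := hK.uniformContinuousOn_of_continuous hgc.continuousOn
  rw [Metric.uniformContinuousOn_iff] at huc
  obtain ⟨δ, hδ, huc⟩ := huc ε hε
  have hP0 : 0 ≤ max p₁ p₂ := hp₁.le.trans (le_max_left _ _)
  have hP1 : max p₁ p₂ < 1 := max_lt (by linarith) (by linarith)
  obtain ⟨n, hn1, hn2⟩ : ∃ n : ℕ, 1 / ((n:ℝ) + 1) < δ ∧ (max p₁ p₂) ^ n < δ := by
    have h1 : ∀ᶠ n : ℕ in atTop, 1 / ((n:ℝ) + 1) < δ :=
      tendsto_one_div_add_atTop_nhds_zero_nat.eventually_lt_const hδ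
    have h2 : ∀ᶠ n : ℕ in atTop, (max p₁ p₂) ^ n < δ :=
      (tendsto_pow_atTop_nhds_zero_of_lt_one hP0 hP1).eventually_lt_const hδ
    exact (h1.and h2).exists
  have hosc : ∀ c : Fin n → Bool × Bool, ∀ z ∈ sq, ∀ w ∈ sq, z ∈ cyl α β p₁ p₂ n c →
      w ∈ cyl α β p₁ p₂ n c → |g z - g w| < ε := by
    intro c z hz w hw hzc hwc
    obtain ⟨h1, h2⟩ := cyl_small hα hαβ hβ hp₁ hp₂ hp n c z w hz hw hzc hwc
    refine huc z hz w hw ?_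
    rw [Prod.dist_eq, Real.dist_eq, Real.dist_eq]
    exact max_lt (h1.trans_lt hn1) (h2.trans_lt hn2)
  have hstep : ∀ c : Fin n → Bool × Bool, ∃ a : ℝ, 0 ≤ a ∧ ∀ z ∈ sq, z ∈ cyl α β p₁ p₂ n c →
      |f z - a| ≤ ‖f z - g z‖ + ε := by
    intro c
    by_cases hne : (sq ∩ cyl α β p₁ p₂ n c).Nonempty
    · obtain ⟨w, hw, hwc⟩ := hne
      refine ⟨max (g w) 0, le_max_right _ _, fun z hz hzc => ?_⟩
      have h1 := hosc c z hz w hw hzc hwc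
      have h2 : |f z - max (g w) 0| ≤ |f z - g w| := by
        have := abs_max_sub_max_le_abs (f z) (g w) 0
        rwa [max_eq_left (hf0 z)] at this
      calc |f z - max (g w) 0| ≤ |f z - g w| := h2
        _ ≤ |f z - g z| + |g z - g w| := abs_sub_le _ _ _
        _ ≤ _ := by rw [Real.norm_eq_abs]; linarith
    · refine ⟨0, le_rfl, fun z hz hzc => absurd ⟨z, hz, hzc⟩ hne⟩
  choose a ha0 ha using hstep
  have hkS : Measurable (fun z => k (S^[n] z)) := hk.comp (hS.iterate n)
  have hbd : ∀ {m : Measure (ℝ × ℝ)} [IsFiniteMeasure m], Integrable (fun z => k (S^[n] z)) m := by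
    intro m _
    exact Integrable.of_bound hkS.aestronglyMeasurable 1 (Eventually.of_forall fun z => hk1 _)
  have e1 : ∫ z, k z ∂ν = ∫ z, f z * k (S^[n] z) ∂LL := by
    have h1 := (hinv.iterate n).map_eq
    have h2 : ∫ z, k z ∂ν = ∫ z, k (S^[n] z) ∂ν := by
      conv_lhs => rw [← h1]
      exact integral_map (hS.iterate n).aemeasurable hk.aestronglyMeasurable
    rw [h2, ← integral_rnDeriv_smul hac]
    rfl
  have hfk : Integrable (fun z => f z * k (S^[n] z)) LL := by
    refine hfi.mul_bdd (c := 1) hkS.aestronglyMeasurable (Eventually.of_forall fun z => hk1 _)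
  have herr : Integrable (fun z => ‖f z - g z‖ + ε) LL :=
    (hfi.sub hgi).norm.add (integrable_const _)
  have hcyl : ∀ c, -∫ z in cyl α β p₁ p₂ n c, (‖f z - g z‖ + ε) ∂LL ≤
      ∫ z in cyl α β p₁ p₂ n c, f z * k (S^[n] z) ∂LL := by
    intro c
    have h0 : 0 ≤ ∫ z in cyl α β p₁ p₂ n c, k (S^[n] z) ∂LL := by
      have := hkD _ (DD_cyl hα hαβ hβ hp₁ hp₂ hp n c DD_LL)
      rwa [integral_map (hS.iterate n).aemeasurable hk.aestronglyMeasurable] at this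
    have h1 : ∫ z in cyl α β p₁ p₂ n c, (a c * k (S^[n] z) - (‖f z - g z‖ + ε)) ∂LL ≤
        ∫ z in cyl α β p₁ p₂ n c, f z * k (S^[n] z) ∂LL := by
      refine integral_mono_ae ((hbd.const_mul _).sub herr.integrableOn) hfk.integrableOn ?_
      filter_upwards [ae_restrict_mem (measurableSet_cyl α β p₁ p₂ n c),
        ae_restrict_of_ae ae_sq] with z hz1 hz2
      have h2 := ha c z hz2 hz1
      have h3 : |(f z - a c) * k (S^[n] z)| ≤ |f z - a c| := by
        rw [abs_mul]
        exact mul_le_of_le_one_right (abs_nonneg _) (hk1 _)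
      have h4 := neg_abs_le ((f z - a c) * k (S^[n] z))
      linarith
    rw [integral_sub (hbd.const_mul _) herr.integrableOn, integral_const_mul] at h1
    have := mul_nonneg (ha0 c) h0
    linarith
  have hsum : ∀ {F : ℝ × ℝ → ℝ}, Integrable F LL →
      ∫ z, F z ∂LL = ∑ c, ∫ z in cyl α β p₁ p₂ n c, F z ∂LL := by
    intro F hF
    rw [← integral_iUnion_fintype (measurableSet_cyl α β p₁ p₂ n) (cyl_disj α β p₁ p₂ n)
      (fun c => hF.integrableOn), cyl_cover, Measure.restrict_univ]
  have hfin : -∫ z, (‖f z - g z‖ + ε) ∂LL ≤ ∫ z, f z * k (S^[n] z) ∂LL := by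
    rw [hsum herr, hsum hfk, ← Finset.sum_neg_distrib]
    exact Finset.sum_le_sum fun c _ => hcyl c
  have hnorm : Integrable (fun z => ‖f z - g z‖) LL := (hfi.sub hgi).norm
  rw [integral_add hnorm (integrable_const _), integral_const] at hfin
  simp only [probReal_univ, one_smul] at hfin
  rw [e1]
  linarith

lemma DD_minor {m : Measure (ℝ × ℝ)} (hm : DD m) {x₀ x₁ : ℝ} (h0 : 0 < x₀) (h01 : x₀ < x₁)
    (h1 : x₁ ≤ 1) {A : Set (ℝ × ℝ)} :
    ((volume.restrict (Ioc 0 x₀)).prod lam).real A * m.real (Ioc x₀ x₁ ×ˢ univ) ≤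
      (x₁ - x₀) * m.real A := by
  obtain ⟨μ, hμ, rfl⟩ := hm
  have := hμ.fin
  have h2 := Measure.prod_mono (good_minor hμ h0 h01 h1) (le_refl lam)
  rw [Measure.prod_smul_left] at h2
  have h3 := h2 A
  rw [Measure.smul_apply, smul_eq_mul] at h3
  have h4 := ENNReal.toReal_mono (measure_ne_top _ _) h3
  have hc0 : 0 ≤ μ.real (Ioc x₀ x₁) / (x₁ - x₀) := div_nonneg measureReal_nonneg (by linarith)
  rw [ENNReal.toReal_mul, ENNReal.toReal_ofReal hc0, ← measureReal_def, ← measureReal_def] at h4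
  have h5 : (μ.prod lam).real (Ioc x₀ x₁ ×ˢ univ) = μ.real (Ioc x₀ x₁) := by
    simp [measureReal_def, Measure.prod_prod]
  rw [h5]
  have h6 : 0 < x₁ - x₀ := by linarith
  rw [div_mul_eq_mul_div, div_le_iff₀ h6] at h4
  linarith

lemma acip_minor {α β p₁ p₂ : ℝ} (hα : 0 < α) (hαβ : α < β) (hβ : β ≤ 1)
    (hp₁ : 0 < p₁) (hp₂ : 0 < p₂) (hp : p₁ + p₂ = 1) {ν : Measure (ℝ × ℝ)}
    [IsProbabilityMeasure ν] (hac : ν ≪ LL)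
    (hinv : MeasurePreserving (skew α β p₁ p₂) ν ν) {x₀ x₁ : ℝ} (h0 : 0 < x₀) (h01 : x₀ < x₁)
    (h1 : x₁ ≤ 1) {A : Set (ℝ × ℝ)} (hA : MeasurableSet A) :
    ((volume.restrict (Ioc 0 x₀)).prod lam).real A * ν.real (Ioc x₀ x₁ ×ˢ univ) ≤
      (x₁ - x₀) * ν.real A := by
  set κ := ((volume.restrict (Ioc 0 x₀)).prod lam).real A with hκ
  have hκ0 : 0 ≤ κ := measureReal_nonneg
  have hκ1 : κ ≤ 1 := by
    have : κ ≤ ((volume.restrict (Ioc 0 x₀)).prod lam).real univ := measureReal_mono (subset_univ _)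
    refine this.trans ?_
    rw [← univ_prod_univ, measureReal_def, Measure.prod_prod]
    simp
    rw [ENNReal.toReal_ofReal h0.le]; linarith
  set B : Set (ℝ × ℝ) := Ioc x₀ x₁ ×ˢ univ with hB
  have hBm : MeasurableSet B := measurableSet_Ioc.prod MeasurableSet.univ
  let k : ℝ × ℝ → ℝ := fun z => A.indicator (fun _ => x₁ - x₀) z - B.indicator (fun _ => κ) z
  have hkint : ∀ (m : Measure (ℝ × ℝ)) [IsFiniteMeasure m],
      ∫ z, k z ∂m = (x₁ - x₀) * m.real A - κ * m.real B := by
    intro m _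
    simp only [k]
    rw [integral_sub ((integrable_const _).indicator hA) ((integrable_const _).indicator hBm),
      integral_indicator_const _ hA, integral_indicator_const _ hBm]
    simp only [smul_eq_mul]
    ring
  have := core hα hαβ hβ hp₁ hp₂ hp (k := k) ?_ ?_ ?_ hac hinv
  · rw [hkint] at this
    linarith
  · exact (measurable_const.indicator hA).sub (measurable_const.indicator hBm)
  · intro z
    simp only [k, indicator]
    rw [abs_le]
    split_ifs <;> constructor <;> linarith
  · intro m hm
    have hm' := DD_minor hm h0 h01 h1 (A := A)
    obtain ⟨μ, hμ, rfl⟩ := hm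
    have := hμ.fin
    rw [hkint]
    linarith

lemma acip_null {α β p₁ p₂ : ℝ} (hα : 0 < α) (hαβ : α < β) (hβ : β ≤ 1)
    (hp₁ : 0 < p₁) (hp₂ : 0 < p₂) (hp : p₁ + p₂ = 1) {ν : Measure (ℝ × ℝ)}
    [IsProbabilityMeasure ν] (hac : ν ≪ LL)
    (hinv : MeasurePreserving (skew α β p₁ p₂) ν ν) :
    ∃ x₀ : ℝ, 0 < x₀ ∧ ∀ A, MeasurableSet A → ν A = 0 →
      ((volume.restrict (Ioc 0 x₀)).prod lam) A = 0 := by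
  have hex : ∃ n : ℕ, ν (Ioc (1 / ((n:ℝ) + 2)) 1 ×ˢ univ) ≠ 0 := by
    by_contra hcon
    push Not at hcon
    have h1 : ν (⋃ n : ℕ, Ioc (1 / ((n:ℝ) + 2)) 1 ×ˢ univ) = 0 := measure_iUnion_null hcon
    have h2 : ∀ᵐ z ∂ν, z ∈ (⋃ n : ℕ, Ioc (1 / ((n:ℝ) + 2)) 1 ×ˢ (univ : Set ℝ)) := by
      apply hac.ae_le
      have h3 : LL (Iic 0 ×ˢ univ) = 0 := by
        rw [LL, Measure.prod_prod, good_lam.zero, zero_mul]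
      have h4 : ∀ᵐ z ∂LL, z ∉ (Iic (0:ℝ) ×ˢ (univ : Set ℝ)) := measure_eq_zero_iff_ae_notMem.mp h3
      filter_upwards [h4, ae_sq] with z hz hz2
      have hz0 : 0 < z.1 := by
        by_contra h; exact hz ⟨not_lt.mp h, mem_univ _⟩
      obtain ⟨n, hn⟩ := exists_nat_one_div_lt hz0
      refine mem_iUnion.mpr ⟨n, ⟨lt_trans ?_ hn, hz2.1.2⟩, mem_univ _⟩
      exact one_div_lt_one_div_of_lt (by positivity) (by linarith)
    have h5 : ∀ᵐ z ∂ν, z ∉ (⋃ n : ℕ, Ioc (1 / ((n:ℝ) + 2)) 1 ×ˢ (univ : Set ℝ)) :=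
      measure_eq_zero_iff_ae_notMem.mp h1
    obtain ⟨z, hz⟩ := (h2.and h5).exists
    exact hz.2 hz.1
  obtain ⟨n, hn⟩ := hex
  have hx0 : 0 < 1 / ((n:ℝ) + 2) := by positivity
  have hx1 : 1 / ((n:ℝ) + 2) < 1 := by
    rw [div_lt_one (by positivity)]
    have : (0:ℝ) ≤ n := Nat.cast_nonneg n
    linarith
  refine ⟨1 / ((n:ℝ) + 2), hx0, fun A hA hA0 => ?_⟩
  have h := acip_minor hα hαβ hβ hp₁ hp₂ hp hac hinv hx0 hx1 le_rfl hA
  have hz : ν.real A = 0 := by rw [measureReal_def, hA0]; rfl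
  rw [hz, mul_zero] at h
  have hpos : 0 < ν.real (Ioc (1 / ((n:ℝ) + 2)) 1 ×ˢ univ) :=
    ENNReal.toReal_pos hn (measure_ne_top _ _)
  have h0 : ((volume.restrict (Ioc 0 (1 / ((n:ℝ) + 2)))).prod lam).real A = 0 := by
    refine le_antisymm ?_ measureReal_nonneg
    by_contra hc
    rw [not_le] at hc
    have := mul_pos hc hpos
    linarith
  rw [measureReal_def, ENNReal.toReal_eq_zero_iff] at h0
  exact h0.resolve_right (measure_ne_top _ _)

lemma acip_not_singular {α β p₁ p₂ : ℝ} (hα : 0 < α) (hαβ : α < β) (hβ : β ≤ 1)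
    (hp₁ : 0 < p₁) (hp₂ : 0 < p₂) (hp : p₁ + p₂ = 1) {ν ν' : Measure (ℝ × ℝ)}
    [IsProbabilityMeasure ν] (hac : ν ≪ LL) (hinv : MeasurePreserving (skew α β p₁ p₂) ν ν)
    [IsProbabilityMeasure ν'] (hac' : ν' ≪ LL)
    (hinv' : MeasurePreserving (skew α β p₁ p₂) ν' ν') {A : Set (ℝ × ℝ)} (hA : MeasurableSet A)
    (h1 : ν A = 0) (h2 : ν' Aᶜ = 0) : False := by
  obtain ⟨x, hx, h⟩ := acip_null hα hαβ hβ hp₁ hp₂ hp hac hinv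
  obtain ⟨x', hx', h'⟩ := acip_null hα hαβ hβ hp₁ hp₂ hp hac' hinv'
  have e1 := h A hA h1
  have e2 := h' Aᶜ hA.compl h2
  set y := min x x' with hy
  have hy0 : 0 < y := lt_min hx hx'
  have key : ∀ t, y ≤ t → (volume.restrict (Ioc 0 y)).prod lam ≤
      (volume.restrict (Ioc 0 t)).prod lam := fun t ht =>
    Measure.prod_mono (Measure.restrict_mono (Ioc_subset_Ioc_right ht) le_rfl) le_rfl
  have e3 : ((volume.restrict (Ioc 0 y)).prod lam) A = 0 :=
    le_antisymm ((key x (min_le_left _ _) A).trans e1.le) bot_le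
  have e4 : ((volume.restrict (Ioc 0 y)).prod lam) Aᶜ = 0 :=
    le_antisymm ((key x' (min_le_right _ _) Aᶜ).trans e2.le) bot_le
  have e5 : ((volume.restrict (Ioc 0 y)).prod lam) univ = 0 := by
    rw [← union_compl_self A]
    exact measure_union_null e3 e4
  rw [← univ_prod_univ, Measure.prod_prod] at e5
  simp at e5
  linarith

lemma acip_ergodic {α β p₁ p₂ : ℝ} (hα : 0 < α) (hαβ : α < β) (hβ : β ≤ 1)
    (hp₁ : 0 < p₁) (hp₂ : 0 < p₂) (hp : p₁ + p₂ = 1) {ν : Measure (ℝ × ℝ)}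
    [IsProbabilityMeasure ν] (hac : ν ≪ LL) (hinv : MeasurePreserving (skew α β p₁ p₂) ν ν) :
    Ergodic (skew α β p₁ p₂) ν := by
  have cond_inv : ∀ B : Set (ℝ × ℝ), MeasurableSet B → skew α β p₁ p₂ ⁻¹' B = B →
      MeasurePreserving (skew α β p₁ p₂) (ProbabilityTheory.cond ν B)
        (ProbabilityTheory.cond ν B) := by
    intro B hB hSB
    have h1 := hinv.restrict_preimage hB
    rw [hSB] at h1
    exact h1.smul_measure _
  have cond_ac : ∀ B : Set (ℝ × ℝ), ProbabilityTheory.cond ν B ≪ LL := fun B =>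
    (ProbabilityTheory.cond_absolutelyContinuous).trans hac
  refine ⟨hinv, ⟨fun B hB hSB => ?_⟩⟩
  rw [eventuallyConst_set']
  by_contra hcon
  rw [not_or] at hcon
  have hB0 : ν B ≠ 0 := fun h => hcon.1 (ae_eq_empty.mpr h)
  have hB1 : ν Bᶜ ≠ 0 := fun h => hcon.2 (ae_eq_univ.mpr h)
  have hSB' : skew α β p₁ p₂ ⁻¹' Bᶜ = Bᶜ := by rw [preimage_compl, hSB]
  have := ProbabilityTheory.cond_isProbabilityMeasure hB0
  have := ProbabilityTheory.cond_isProbabilityMeasure hB1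
  refine acip_not_singular hα hαβ hβ hp₁ hp₂ hp (cond_ac Bᶜ) (cond_inv Bᶜ hB.compl hSB')
    (cond_ac B) (cond_inv B hB hSB) hB ?_ ?_
  · rw [ProbabilityTheory.cond_apply hB.compl]; simp
  · rw [ProbabilityTheory.cond_apply hB]; simp

lemma acip_unique {α β p₁ p₂ : ℝ} (hα : 0 < α) (hαβ : α < β) (hβ : β ≤ 1)
    (hp₁ : 0 < p₁) (hp₂ : 0 < p₂) (hp : p₁ + p₂ = 1) {ν ν' : Measure (ℝ × ℝ)}
    [IsProbabilityMeasure ν] (hac : ν ≪ LL) (hinv : MeasurePreserving (skew α β p₁ p₂) ν ν)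
    [IsProbabilityMeasure ν'] (hac' : ν' ≪ LL)
    (hinv' : MeasurePreserving (skew α β p₁ p₂) ν' ν') : ν = ν' := by
  let ρ : Measure (ℝ × ℝ) := (2⁻¹ : ENNReal) • (ν + ν')
  have hρ : IsProbabilityMeasure ρ := ⟨by
    simp only [ρ, Measure.smul_apply, Measure.add_apply, measure_univ, smul_eq_mul]
    rw [one_add_one_eq_two, ENNReal.inv_mul_cancel] <;> simp⟩
  have hρac : ρ ≪ LL := by
    refine Measure.AbsolutelyContinuous.trans Measure.smul_absolutelyContinuous ?_
    exact Measure.AbsolutelyContinuous.add_left hac hac'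
  have hρinv : MeasurePreserving (skew α β p₁ p₂) ρ ρ := by
    refine MeasurePreserving.smul_measure ?_ _
    refine ⟨hinv.measurable, ?_⟩
    rw [Measure.map_add _ _ hinv.measurable, hinv.map_eq, hinv'.map_eq]
  have herg := acip_ergodic hα hαβ hβ hp₁ hp₂ hp hρac hρinv
  have h1 : ν + ν' ≪ ρ := Measure.absolutelyContinuous_smul (by simp)
  have a1 : ν ≪ ρ := (Measure.AbsolutelyContinuous.rfl.add_right ν').trans h1
  have a2 : ν' ≪ ρ := by
    rw [add_comm] at h1
    exact (Measure.AbsolutelyContinuous.rfl.add_right ν).trans h1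
  rw [herg.eq_of_absolutelyContinuous hinv a1, herg.eq_of_absolutelyContinuous hinv' a2]

end SkewAcip

namespace SkewAcip

/-! ### Analytic estimates for existence -/

lemma mono_beta {s γ : ℝ} (hs : 0 < s) (hγ : 0 < γ) :
    MonotoneOn (fun y => (lsv γ y) ^ s - y ^ s) (Icc 0 (1 / 2)) := by
  have key : ∀ y ∈ Icc (0:ℝ) (1/2), (lsv γ y) ^ s - y ^ s = y ^ s * ((1 + (2 * y) ^ γ) ^ s - 1) := by
    intro y hy
    have h0 : 0 ≤ (2 * y) ^ γ := Real.rpow_nonneg (by linarith [hy.1]) _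
    rw [lsv_eq hy.1 hy.2, show y + y * (2 * y) ^ γ = y * (1 + (2 * y) ^ γ) by ring,
      Real.mul_rpow hy.1 (by linarith)]
    ring
  intro x hx y hy hxy
  simp only [key x hx, key y hy]
  have h0 : 0 ≤ (2 * x) ^ γ := Real.rpow_nonneg (by linarith [hx.1]) _
  have h1 : (2 * x) ^ γ ≤ (2 * y) ^ γ :=
    Real.rpow_le_rpow (by linarith [hx.1]) (by linarith) hγ.le
  have h2 : (1 + (2 * x) ^ γ) ^ s ≤ (1 + (2 * y) ^ γ) ^ s :=
    Real.rpow_le_rpow (by linarith) (by linarith) hs.le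
  have h3 : 1 ≤ (1 + (2 * x) ^ γ) ^ s := Real.one_le_rpow (by linarith) hs.le
  exact mul_le_mul (Real.rpow_le_rpow hx.1 hxy hs.le) (by linarith) (by linarith)
    (Real.rpow_nonneg hy.1 _)

lemma mono_alpha {α p C : ℝ} (hα : 0 < α) (hα1 : α < 1) (hp : 0 < p)
    (hC : 6 ≤ C * (1 - α) * p) :
    MonotoneOn (fun y => C * ((lsv α y) ^ (1 - α) - y ^ (1 - α)) - lsv α y / p)
      (Icc 0 (1 / 2)) := by
  have hs : 0 < 1 - α := by linarith
  set f : ℝ → ℝ := fun y => C * ((y + y * (2 * y) ^ α) ^ (1 - α) - y ^ (1 - α))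
    - (y + y * (2 * y) ^ α) / p with hf
  suffices h : MonotoneOn f (Icc 0 (1 / 2)) by
    refine h.congr (fun y hy => ?_)
    simp only [hf, lsv_eq hy.1 hy.2]
  have hT : Continuous (fun y : ℝ => y + y * (2 * y) ^ α) := by
    have := (Real.continuous_rpow_const hα.le).comp (continuous_const_mul (2:ℝ))
    exact continuous_id.add (continuous_id.mul this)
  have hder : ∀ y ∈ Ioo (0:ℝ) (1/2), HasDerivAt f
      (C * ((1 + (1 + α) * (2 * y) ^ α) * (1 - α) * (y + y * (2 * y) ^ α) ^ (1 - α - 1)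
        - (1 - α) * y ^ (1 - α - 1)) - (1 + (1 + α) * (2 * y) ^ α) / p) y := by
    intro y hy
    have hu : 0 < (2 * y) ^ α := Real.rpow_pos_of_pos (by linarith [hy.1]) _
    have d1 : HasDerivAt (fun y : ℝ => (2 * y) ^ α) (2 * 1 * α * (2 * y) ^ (α - 1)) y :=
      ((hasDerivAt_id y).const_mul 2).rpow_const (Or.inl (by simp; linarith [hy.1]))
    have d2 : HasDerivAt (fun y : ℝ => y + y * (2 * y) ^ α) (1 + (1 + α) * (2 * y) ^ α) y := by
      have := (hasDerivAt_id y).add ((hasDerivAt_id y).mul d1)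
      refine this.congr_deriv ?_
      have : (2 * y) ^ (α - 1) * (2 * y) = (2 * y) ^ α := by
        rw [Real.rpow_sub_one (by linarith [hy.1])]
        field_simp [hy.1.ne']
      simp only [id]
      linear_combination α * this
    have d3 := d2.rpow_const (p := 1 - α) (Or.inl (by nlinarith [hy.1]))
    have d4 := Real.hasDerivAt_rpow_const (x := y) (p := 1 - α) (Or.inl hy.1.ne')
    exact ((d3.sub d4).const_mul C).sub (d2.div_const p)
  refine monotoneOn_of_deriv_nonneg (convex_Icc _ _) ?_ ?_ ?_
  · apply Continuous.continuousOn
    exact (continuous_const.mul (((Real.continuous_rpow_const hs.le).comp hT).sub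
      (Real.continuous_rpow_const hs.le))).sub (hT.div_const p)
  · rw [interior_Icc]
    exact fun y hy => (hder y hy).differentiableAt.differentiableWithinAt
  · rw [interior_Icc]
    intro y hy
    rw [(hder y hy).deriv]
    have hy0 := hy.1
    set u := (2 * y) ^ α with hu
    have hu0 : 0 < u := Real.rpow_pos_of_pos (by linarith) _
    have hu1 : u ≤ 1 := Real.rpow_le_one (by linarith) (by linarith [hy.2]) hα.le
    have e1 : (1 - α - 1) = -α := by ring
    rw [e1, show y + y * u = y * (1 + u) by ring, Real.mul_rpow hy0.le (by linarith)]
    have hv : (1 + u) ^ (-α) * (1 + α * u) ≥ 1 := by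
      have hb : (1 + u) ^ α ≤ 1 + α * u :=
        _root_.rpow_one_add_le_one_add_mul_self (by linarith) hα.le hα1.le
      have hpos : 0 < (1 + u) ^ α := Real.rpow_pos_of_pos (by linarith) _
      rw [Real.rpow_neg (by linarith), ge_iff_le, ← div_eq_inv_mul, one_le_div hpos]
      exact hb
    set v := (1 + u) ^ (-α) with hvd
    have hv0 : 0 < v := Real.rpow_pos_of_pos (by linarith) _
    have hyu : 1 ≤ y ^ (-α) * u := by
      rw [hu, Real.mul_rpow (by norm_num) hy0.le, Real.rpow_neg hy0.le]
      have : y ^ α ≠ 0 := (Real.rpow_pos_of_pos hy0 _).ne'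
      field_simp
      exact Real.one_le_rpow (by norm_num) hα.le
    set w := y ^ (-α) with hw
    have hw0 : 0 < w := Real.rpow_pos_of_pos hy0 _
    have hv2 : 1 / 2 ≤ v := by
      by_contra hc
      push Not at hc
      have : α * u ≤ 1 := by nlinarith
      nlinarith
    have h1 : u / 2 ≤ (1 + (1 + α) * u) * v - 1 := by nlinarith
    have h2 : 1 / 2 ≤ w * ((1 + (1 + α) * u) * v - 1) := by nlinarith
    have hC0 : 0 ≤ C * (1 - α) := by
      by_contra hc
      push Not at hc
      nlinarith
    have h3 : (1 + (1 + α) * u) / p ≤ C * (1 - α) / 2 := by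
      rw [div_le_iff₀ hp]
      nlinarith
    have h4 := mul_le_mul_of_nonneg_left h2 hC0
    nlinarith

lemma mono_lam {α C : ℝ} (hα : 0 < α) (hα1 : α < 1) (hC : 1 ≤ C * (1 - α)) :
    MonotoneOn (fun y => C * y ^ (1 - α) - y) (Icc 0 1) := by
  have hs : 0 < 1 - α := by linarith
  have hder : ∀ y ∈ Ioo (0:ℝ) 1, HasDerivAt (fun y => C * y ^ (1 - α) - y)
      (C * ((1 - α) * y ^ (1 - α - 1)) - 1) y := fun y hy =>
    ((Real.hasDerivAt_rpow_const (Or.inl hy.1.ne')).const_mul C).sub (hasDerivAt_id y)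
  refine monotoneOn_of_deriv_nonneg (convex_Icc _ _) ?_ ?_ ?_
  · exact ((continuous_const.mul (Real.continuous_rpow_const hs.le)).sub
      continuous_id).continuousOn
  · rw [interior_Icc]
    exact fun y hy => (hder y hy).differentiableAt.differentiableWithinAt
  · rw [interior_Icc]
    intro y hy
    rw [(hder y hy).deriv]
    have : 1 ≤ y ^ (1 - α - 1) :=
      Real.one_le_rpow_of_pos_of_le_one_of_nonpos hy.1 hy.2.le (by linarith)
    nlinarith

end SkewAcip

namespace SkewAcip

/-! ### Krylov-Bogoliubov along an ultrafilter, for dominated sequences -/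

open Topology in
lemma exists_invariant {X : Type*} [MeasurableSpace X] {S : X → X} (hS : Measurable S)
    (ρ : ℕ → Measure X) (hprob : ∀ k, IsProbabilityMeasure (ρ k))
    (hstep : ∀ k, (ρ k).map S = ρ (k + 1)) (H : Measure X) [IsFiniteMeasure H]
    (hH : ∀ k, ρ k ≤ H) :
    ∃ ν : Measure X, IsProbabilityMeasure ν ∧ ν ≤ H ∧ MeasurePreserving S ν ν := by
  set U : Filter ℕ := (hyperfilter ℕ : Filter ℕ) with hU
  have hUle : U ≤ atTop := by
    rw [← Nat.cofinite_eq_atTop]; exact hyperfilter_le_cofinite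
  let N : ℕ → Set X → ENNReal := fun n A => ((n:ENNReal) + 1)⁻¹ * ∑ k ∈ Finset.range (n + 1), ρ k A
  have hn0 : ∀ n : ℕ, ((n:ENNReal) + 1) ≠ 0 := fun n => by simp
  have hnt : ∀ n : ℕ, ((n:ENNReal) + 1) ≠ ⊤ := fun n => by finiteness
  have hex : ∀ A, ∃ l, Tendsto (fun n => N n A) U (𝓝 l) := by
    intro A
    obtain ⟨l, -, hl⟩ := isCompact_univ.ultrafilter_le_nhds ((hyperfilter ℕ).map fun n => N n A)
      (by simp)
    exact ⟨l, hl⟩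
  choose L hL using hex
  have hcard : ∀ (n : ℕ) (c : ENNReal), ((n:ENNReal) + 1)⁻¹ * ∑ k ∈ Finset.range (n + 1), c = c := by
    intro n c
    simp only [Finset.sum_const, Finset.card_range, nsmul_eq_mul, Nat.cast_add, Nat.cast_one]
    rw [← mul_assoc, ENNReal.inv_mul_cancel (hn0 n) (hnt n), one_mul]
  have hLH : ∀ A, L A ≤ H A := by
    intro A
    refine le_of_tendsto' (hL A) (fun n => ?_)
    rw [← hcard n (H A)]
    simp only [N]
    gcongr
    exact hH _
  have hL0 : L ∅ = 0 := le_antisymm ((hLH _).trans (by simp)) zero_le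
  have hLu : L univ = 1 := by
    refine tendsto_nhds_unique (hL univ) ?_
    have : (fun n => N n univ) = fun _ => (1 : ENNReal) := by
      funext n
      have := hcard n 1
      simpa [N] using this
    rw [this]
    exact tendsto_const_nhds
  have hadd : ∀ A B, MeasurableSet B → Disjoint A B → L (A ∪ B) = L A + L B := by
    intro A B hB hd
    refine tendsto_nhds_unique (hL (A ∪ B)) ?_
    refine ((hL A).add (hL B)).congr (fun n => ?_)
    simp only [N, ← mul_add, ← Finset.sum_add_distrib]
    congr 1
    exact Finset.sum_congr rfl fun k _ => (measure_union hd hB).symm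
  have hcount : ∀ f : ℕ → Set X, (∀ i, MeasurableSet (f i)) →
      Pairwise (Function.onFun Disjoint f) → L (⋃ i, f i) = ∑' i, L (f i) := by
    intro f hf hd
    have hfin : ∀ n, L (⋃ i, f i) = ∑ i ∈ Finset.range n, L (f i) + L (⋃ i, f (i + n)) := by
      intro n
      induction n with
      | zero => simp
      | succ n ih =>
        have h1 : (⋃ i, f (i + n)) = f n ∪ ⋃ i, f (i + (n + 1)) := by
          ext x
          simp only [mem_iUnion, mem_union]
          constructor
          · rintro ⟨i, hi⟩
            cases i with
            | zero => left; simpa using hi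
            | succ i => right; exact ⟨i, by rwa [show i + (n + 1) = i + 1 + n by ring]⟩
          · rintro (h | ⟨i, hi⟩)
            · exact ⟨0, by simpa using h⟩
            · exact ⟨i + 1, by rwa [show i + 1 + n = i + (n + 1) by ring]⟩
        rw [ih, h1, hadd _ _ (MeasurableSet.iUnion fun i => hf _), Finset.sum_range_succ, add_assoc]
        rw [disjoint_iUnion_right]
        exact fun i => hd (by omega)
    have ht : Tendsto (fun n => L (⋃ i, f (i + n))) atTop (𝓝 0) := by
      have hsum : ∑' i, H (f i) ≠ ⊤ := by
        rw [← measure_iUnion hd hf]; exact measure_ne_top _ _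
      have h2 := ENNReal.tendsto_sum_nat_add (fun i => H (f i)) hsum
      refine tendsto_of_tendsto_of_tendsto_of_le_of_le tendsto_const_nhds h2
        (fun _ => zero_le) (fun n => ?_)
      exact (hLH _).trans (measure_iUnion_le _)
    have h3 : Tendsto (fun n => ∑ i ∈ Finset.range n, L (f i) + L (⋃ i, f (i + n))) atTop
        (𝓝 (∑' i, L (f i) + 0)) := (ENNReal.tendsto_nat_tsum _).add ht
    rw [add_zero] at h3
    refine tendsto_nhds_unique ?_ h3
    exact tendsto_const_nhds.congr hfin
  let ν : Measure X := Measure.ofMeasurable (fun A _ => L A) hL0 hcount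
  have hν : ∀ A, MeasurableSet A → ν A = L A := fun A hA => Measure.ofMeasurable_apply A hA
  refine ⟨ν, ⟨by rw [hν _ MeasurableSet.univ, hLu]⟩, ?_, hS, ?_⟩
  · refine Measure.le_iff.mpr (fun A hA => ?_)
    rw [hν A hA]; exact hLH A
  · ext A hA
    rw [Measure.map_apply hS hA, hν _ (hS hA), hν _ hA]
    have hsh : ∀ n, N n (S ⁻¹' A) = ((n:ENNReal) + 1)⁻¹ * ∑ k ∈ Finset.range (n + 1), ρ (k + 1) A := by
      intro n
      simp only [N]
      congr 1
      refine Finset.sum_congr rfl fun k _ => ?_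
      rw [← hstep k, Measure.map_apply hS hA]
    have htel : ∀ n, ∑ k ∈ Finset.range (n + 1), ρ (k + 1) A + ρ 0 A =
        ∑ k ∈ Finset.range (n + 1), ρ k A + ρ (n + 1) A := by
      intro n
      rw [← Finset.sum_range_succ' (fun k => ρ k A), ← Finset.sum_range_succ (fun k => ρ k A)]
    have hle1 : ∀ k, ρ k A ≤ 1 := fun k => prob_le_one
    have hinv0 : Tendsto (fun n : ℕ => ((n:ENNReal) + 1)⁻¹) U (𝓝 0) := by
      have := (tendsto_add_atTop_iff_nat 1).mpr ENNReal.tendsto_inv_nat_nhds_zero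
      simp only [Nat.cast_add, Nat.cast_one] at this
      exact this.mono_left hUle
    apply le_antisymm
    · have := (hL A).add hinv0
      rw [add_zero] at this
      refine le_of_tendsto_of_tendsto' (hL (S ⁻¹' A)) this (fun n => ?_)
      rw [hsh]
      calc ((n:ENNReal) + 1)⁻¹ * ∑ k ∈ Finset.range (n + 1), ρ (k + 1) A
          ≤ ((n:ENNReal) + 1)⁻¹ * (∑ k ∈ Finset.range (n + 1), ρ k A + 1) := by
            gcongr
            exact le_self_add.trans ((htel n).le.trans (by gcongr; exact hle1 _))
        _ = _ := by rw [mul_add, mul_one]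
    · have := (hL (S ⁻¹' A)).add hinv0
      rw [add_zero] at this
      refine le_of_tendsto_of_tendsto' (hL A) this (fun n => ?_)
      rw [hsh]
      calc ((n:ENNReal) + 1)⁻¹ * ∑ k ∈ Finset.range (n + 1), ρ k A
          ≤ ((n:ENNReal) + 1)⁻¹ * (∑ k ∈ Finset.range (n + 1), ρ (k + 1) A + 1) := by
            gcongr
            exact le_self_add.trans ((htel n).ge.trans (by gcongr; exact hle1 _))
        _ = _ := by rw [mul_add, mul_one]

end SkewAcip

namespace SkewAcip

/-- Good probability measures whose increments are dominated by those of `C x^(1-α)`. -/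
structure Good2 (α C : ℝ) (μ : Measure ℝ) : Prop where
  good : Good μ
  prob : IsProbabilityMeasure μ
  dom : ∀ a b, 0 ≤ a → a ≤ b → b ≤ 1 →
    μ.real (Iic b) - μ.real (Iic a) ≤ C * (b ^ (1 - α) - a ^ (1 - α))

/-- the transfer operator -/
def step (α β p₁ p₂ : ℝ) (μ : Measure ℝ) : Measure ℝ :=
  (ENNReal.ofReal p₁ • pushL α μ + ENNReal.ofReal p₁ • pushR α μ) +
    (ENNReal.ofReal p₂ • pushL β μ + ENNReal.ofReal p₂ • pushR β μ)

lemma map_step (α β : ℝ) {p₁ p₂ : ℝ} (hp₁ : 0 < p₁) (hp₂ : 0 < p₂) (hp : p₁ + p₂ = 1)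
    (μ : Measure ℝ) [IsFiniteMeasure μ] :
    (μ.prod lam).map (skew α β p₁ p₂) = (step α β p₁ p₂ μ).prod lam := by
  have hS := measurable_skew α β p₁ p₂
  have hLf : ∀ γ, IsFiniteMeasure (pushL γ μ) := fun γ => by unfold pushL; infer_instance
  have hRf : ∀ γ, IsFiniteMeasure (pushR γ μ) := fun γ => by unfold pushR; infer_instance
  have h1 : (μ.prod lam) = ∑ b : Bool × Bool, (μ.prod lam).restrict (Q p₁ b) := by
    conv_lhs => rw [← Measure.restrict_univ (μ := μ.prod lam),
      ← eq_univ_of_forall (s := ⋃ b, Q p₁ b) (fun z => mem_iUnion.mpr (Q_cover p₁ z))]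
    rw [Measure.restrict_iUnion (fun b b' h => Set.disjoint_left.mpr
      fun z hz hz' => h (Q_disj hz hz')) (measurableSet_Q p₁), Measure.sum_fintype]
  have e := push_quarter α β hp₁ hp₂ hp μ
  have ett := e (true, true)
  have etf := e (true, false)
  have eft := e (false, true)
  have eff := e (false, false)
  simp only [if_true, Bool.false_eq_true, if_false] at ett etf eft eff
  have hfs : ∀ (c : ℝ) (m : Measure ℝ) [IsFiniteMeasure m], IsFiniteMeasure (ENNReal.ofReal c • m) :=
    fun c m _ => Measure.smul_finite _ (by simp)
  rw [h1, Fintype.sum_prod_type, Fintype.sum_bool, Fintype.sum_bool, Fintype.sum_bool,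
    Measure.map_add _ _ hS, Measure.map_add _ _ hS, Measure.map_add _ _ hS, ett, etf, eft, eff,
    step, Measure.add_prod, Measure.add_prod, Measure.add_prod]
  abel

lemma good2_step {α β p₁ p₂ C : ℝ} (hα : 0 < α) (hαβ : α < β) (hβ : β ≤ 1)
    (hp₁ : 0 < p₁) (hp₂ : 0 < p₂) (hp : p₁ + p₂ = 1) (hC0 : 0 ≤ C)
    (hC : 6 ≤ C * (1 - α) * p₁) {μ : Measure ℝ}
    (h : Good2 α C μ) : Good2 α C (step α β p₁ p₂ μ) := by
  have hg := h.good
  have hpr := h.prob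
  have hα1 : α < 1 := by linarith
  have hβ0 : 0 < β := by linarith
  have gLa := good_pushL hα hα1.le hg
  have gLb := good_pushL hβ0 hβ hg
  have gRa : Good (pushR α μ) := good_pushR hg
  have gRb : Good (pushR β μ) := good_pushR hg
  have good' : Good (step α β p₁ p₂ μ) :=
    good_add (good_add (good_smul gLa) (good_smul gRa)) (good_add (good_smul gLb) (good_smul gRb))
  refine ⟨good', ?_, ?_⟩
  · constructor
    have h1 : (μ.prod lam).map (skew α β p₁ p₂) univ = 1 := by
      rw [Measure.map_apply (measurable_skew α β p₁ p₂) MeasurableSet.univ]; simp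
    have := good'.fin
    rw [map_step α β hp₁ hp₂ hp, ← univ_prod_univ, Measure.prod_prod, measure_univ (μ := lam),
      mul_one] at h1
    exact h1
  · intro a b ha hab hb
    have f1 := gLa.fin
    have f2 := gLb.fin
    have f3 := gRa.fin
    have f4 := gRb.fin
    have hfs : ∀ (c : ℝ) (m : Measure ℝ) [IsFiniteMeasure m],
      IsFiniteMeasure (ENNReal.ofReal c • m) := fun c m _ => Measure.smul_finite _ (by simp)
    set F : ℝ → ℝ := fun x => μ.real (Iic x) with hF
    have hFx : ∀ x ∈ Icc (0:ℝ) 1, (step α β p₁ p₂ μ).real (Iic x) =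
        p₁ * F (linv hα x) + p₂ * F (linv hβ0 x) + (F ((1 + x) / 2) - F (1 / 2)) := by
      intro x hx
      rw [step, measureReal_add_apply, measureReal_add_apply, measureReal_add_apply]
      simp only [measureReal_ennreal_smul_apply, ENNReal.toReal_ofReal hp₁.le,
        ENNReal.toReal_ofReal hp₂.le]
      rw [pushL_real hα hα1.le hg.zero hx, pushL_real hβ0 hβ hg.zero hx, pushR_real hx.1,
        pushR_real hx.1]
      simp only [hF]
      linear_combination (μ.real (Iic ((1 + x) / 2)) - μ.real (Iic (1 / 2))) * hp
    have hxa : a ∈ Icc (0:ℝ) 1 := ⟨ha, hab.trans hb⟩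
    have hxb : b ∈ Icc (0:ℝ) 1 := ⟨ha.trans hab, hb⟩
    rw [hFx a hxa, hFx b hxb]
    have hR : F ((1 + b) / 2) - F ((1 + a) / 2) ≤ b - a := by
      rcases hab.eq_or_lt with rfl | hlt
      · simp
      · have h1 := conc_slope hg.conc (a := 0) (b := 1 / 2) (c := (1 + a) / 2) (d := (1 + b) / 2)
          le_rfl (by norm_num) (by linarith) (by linarith) (by linarith)
        rw [div_le_div_iff₀ (by linarith) (by norm_num)] at h1
        have h2 : μ.real (Iic (1 / 2)) ≤ 1 := measureReal_le_one
        have h3 : 0 ≤ μ.real (Iic 0) := measureReal_nonneg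
        simp only [hF]
        nlinarith
    have hA : p₁ * (F (linv hα b) - F (linv hα a)) ≤
        p₁ * (C * (b ^ (1 - α) - a ^ (1 - α))) - (b - a) := by
      have m1 := linv_mem hα hxa
      have m2 := linv_mem hα hxb
      have m3 := linv_mono hα hα1.le hxa hxb hab
      have h1 := h.dom _ _ m1.1 m3 (by linarith [m2.2])
      have h2 := mono_alpha hα hα1 hp₁ hC m1 m2 m3
      simp only [lsv_linv hα hxa, lsv_linv hα hxb] at h2
      have h3 : F (linv hα b) - F (linv hα a) ≤ C * (b ^ (1 - α) - a ^ (1 - α)) - (b - a) / p₁ := by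
        simp only [hF]
        rw [sub_div]
        linarith
      have h4 := mul_le_mul_of_nonneg_left h3 hp₁.le
      have h5 : p₁ * ((b - a) / p₁) = b - a := by field_simp
      linarith [mul_sub p₁ (C * (b ^ (1 - α) - a ^ (1 - α))) ((b - a) / p₁)]
    have hB : F (linv hβ0 b) - F (linv hβ0 a) ≤ C * (b ^ (1 - α) - a ^ (1 - α)) := by
      have m1 := linv_mem hβ0 hxa
      have m2 := linv_mem hβ0 hxb
      have m3 := linv_mono hβ0 hβ hxa hxb hab
      have h1 := h.dom _ _ m1.1 m3 (by linarith [m2.2])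
      have h2 := mono_beta (s := 1 - α) (by linarith) hβ0 m1 m2 m3
      simp only [lsv_linv hβ0 hxa, lsv_linv hβ0 hxb] at h2
      refine h1.trans (mul_le_mul_of_nonneg_left (by linarith) hC0)
    have hB' := mul_le_mul_of_nonneg_left hB hp₂.le
    have hpp : p₁ * (C * (b ^ (1 - α) - a ^ (1 - α))) + p₂ * (C * (b ^ (1 - α) - a ^ (1 - α)))
      = C * (b ^ (1 - α) - a ^ (1 - α)) := by
      linear_combination (C * (b ^ (1 - α) - a ^ (1 - α))) * hp
    linarith

lemma good2_lam {α C : ℝ} (hα : 0 < α) (hα1 : α < 1) (hC : 1 ≤ C * (1 - α)) : Good2 α C lam := by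
  refine ⟨good_lam, inferInstance, fun a b ha hab hb => ?_⟩
  rw [lam_Iic ⟨ha, hab.trans hb⟩, lam_Iic ⟨ha.trans hab, hb⟩]
  have := mono_lam hα hα1 hC ⟨ha, hab.trans hb⟩ ⟨ha.trans hab, hb⟩ hab
  simp only at this
  linarith

/-- the dominating measure -/
def Gm (α C : ℝ) : Measure ℝ :=
  (volume.restrict (Ioc 0 1)).withDensity (fun x => ENNReal.ofReal (C * (1 - α) * x ^ (-α)))

lemma Gm_apply {α C : ℝ} (hα1 : α < 1) (hC0 : 0 ≤ C) {a b : ℝ} (ha : 0 ≤ a)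
    (hab : a ≤ b) (hb : b ≤ 1) :
    Gm α C (Ioc a b) = ENNReal.ofReal (C * (b ^ (1 - α) - a ^ (1 - α))) := by
  rw [Gm, withDensity_apply _ measurableSet_Ioc, Measure.restrict_restrict measurableSet_Ioc,
    inter_eq_self_of_subset_left (Ioc_subset_Ioc ha hb)]
  have hint : IntervalIntegrable (fun x : ℝ => C * (1 - α) * x ^ (-α)) volume a b :=
    (intervalIntegral.intervalIntegrable_rpow' (by linarith)).const_mul _
  rw [← ofReal_integral_eq_lintegral_ofReal ((intervalIntegrable_iff_integrableOn_Ioc_of_le hab).mp hint),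
    ← intervalIntegral.integral_of_le hab, intervalIntegral.integral_const_mul,
    integral_rpow (Or.inl (by linarith))]
  · congr 1
    have : (1 - α) ≠ 0 := by linarith
    rw [show -α + 1 = 1 - α by ring]
    field_simp
  · refine (ae_restrict_mem measurableSet_Ioc).mono (fun x hx => ?_)
    have : 0 ≤ x ^ (-α) := Real.rpow_nonneg (ha.trans hx.1.le) _
    have : 0 ≤ 1 - α := by linarith
    simp only [Pi.zero_apply]
    positivity

lemma Gm_fin {α C : ℝ} (hα1 : α < 1) (hC0 : 0 ≤ C) : IsFiniteMeasure (Gm α C) := by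
  constructor
  have h1 := Gm_apply (α := α) hα1 hC0 (a := 0) (b := 1) le_rfl zero_le_one le_rfl
  have : Gm α C univ = Gm α C (Ioc 0 1) := by
    simp only [Gm]
    rw [withDensity_apply _ MeasurableSet.univ, withDensity_apply _ measurableSet_Ioc,
      Measure.restrict_restrict measurableSet_Ioc, inter_self, Measure.restrict_univ]
  rw [this, h1]
  exact ENNReal.ofReal_lt_top

lemma Gm_ac (α C : ℝ) : Gm α C ≪ lam := by
  refine (withDensity_absolutelyContinuous _ _).trans ?_
  exact (Measure.restrict_mono Ioc_subset_Icc_self le_rfl).absolutelyContinuous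

lemma good2_le {α C : ℝ} (hα1 : α < 1) (hC0 : 0 ≤ C) {μ : Measure ℝ}
    (h : Good2 α C μ) : μ ≤ Gm α C := by
  have := h.prob
  have := Gm_fin hα1 hC0
  refine le_of_Ioc (fun a b hab => ?_)
  have hsub : μ (Ioc a b \ Ioc 0 1) = 0 := by
    refine measure_mono_null (t := Iic 0 ∪ Ioi 1) ?_ (measure_union_null h.good.zero h.good.one)
    rintro x ⟨-, hx⟩
    simp only [mem_union, mem_Iic, mem_Ioi]
    by_contra hc
    push Not at hc
    exact hx ⟨hc.1, hc.2⟩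
  have e1 : μ.real (Ioc a b) = μ.real (Ioc (max a 0) (min b 1)) := by
    rw [← Ioc_inter_Ioc]
    rw [measureReal_def, measureReal_def, ← measure_inter_add_sdiff (Ioc a b) (measurableSet_Ioc (a := (0:ℝ)) (b := 1)), hsub, add_zero]
  rw [e1]
  rcases le_or_gt (max a 0) (min b 1) with hle | hlt
  · rw [real_Ioc hle]
    refine (h.dom _ _ (le_max_right _ _) hle (min_le_right _ _)).trans ?_
    refine le_trans ?_ (measureReal_mono (Ioc_subset_Ioc (le_max_left a 0) (min_le_left b 1)))
    rw [measureReal_def, Gm_apply hα1 hC0 (le_max_right _ _) hle (min_le_right _ _)]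
    exact (ENNReal.toReal_ofReal_eq_iff.mpr (mul_nonneg hC0 (sub_nonneg.mpr
      (Real.rpow_le_rpow (le_max_right _ _) hle (by linarith))))).ge
  · rw [Ioc_eq_empty hlt.not_gt]
    simp

end SkewAcip

namespace SkewAcip

lemma acip_exists {α β p₁ p₂ : ℝ} (hα : 0 < α) (hαβ : α < β) (hβ : β ≤ 1)
    (hp₁ : 0 < p₁) (hp₂ : 0 < p₂) (hp : p₁ + p₂ = 1) :
    ∃ ν : Measure (ℝ × ℝ), IsProbabilityMeasure ν ∧ ν ≪ LL ∧
      MeasurePreserving (skew α β p₁ p₂) ν ν := by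
  have hα1 : α < 1 := by linarith
  have hs : 0 < 1 - α := by linarith
  obtain ⟨C, hC0, hC, hC1⟩ : ∃ C : ℝ, 0 ≤ C ∧ 6 ≤ C * (1 - α) * p₁ ∧ 1 ≤ C * (1 - α) := by
    refine ⟨6 / ((1 - α) * p₁), by positivity, ?_, ?_⟩
    · have : 6 / ((1 - α) * p₁) * (1 - α) * p₁ = 6 := by field_simp
      linarith
    · have : 6 / ((1 - α) * p₁) * (1 - α) = 6 / p₁ := by field_simp
      rw [this, le_div_iff₀ hp₁]
      linarith
  let μ : ℕ → Measure ℝ := fun k => (step α β p₁ p₂)^[k] lam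
  have hμ : ∀ k, Good2 α C (μ k) := by
    intro k
    induction k with
    | zero => exact good2_lam hα hα1 hC1
    | succ k ih =>
      simp only [μ, Function.iterate_succ_apply']
      exact good2_step hα hαβ hβ hp₁ hp₂ hp hC0 hC ih
  have hfin := fun k => (hμ k).prob
  have hGf := Gm_fin hα1 hC0
  obtain ⟨ν, h1, h2, h3⟩ := exists_invariant (measurable_skew α β p₁ p₂)
    (fun k => (μ k).prod lam) (fun k => inferInstance) (fun k => by
      rw [map_step α β hp₁ hp₂ hp]
      simp only [μ, Function.iterate_succ_apply'])
    ((Gm α C).prod lam) (fun k => Measure.prod_mono (good2_le hα1 hC0 (hμ k)) le_rfl)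
  exact ⟨ν, h1, h2.absolutelyContinuous.trans ((Gm_ac α C).prod .rfl), h3⟩

end SkewAcip

/-- For `0 < α < β ≤ 1` and `p₁, p₂ > 0` with `p₁ + p₂ = 1`, the skew
product `S` admits a unique absolutely continuous invariant probability measure on
`[0,1] × [0,1]`. -/
theorem skew_exists_unique_acip (α β p₁ p₂ : ℝ) (hα : 0 < α) (hαβ : α < β) (hβ : β ≤ 1)
    (hp₁ : 0 < p₁) (hp₂ : 0 < p₂) (hp : p₁ + p₂ = 1) :
    ∃! ν : Measure (ℝ × ℝ), IsProbabilityMeasure ν ∧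
      ν ≪ volume.restrict (Set.Icc (0 : ℝ) 1 ×ˢ Set.Icc (0 : ℝ) 1) ∧
      ∀ A : Set (ℝ × ℝ), MeasurableSet A → ν (skew α β p₁ p₂ ⁻¹' A) = ν A := by
  have hS := SkewAcip.measurable_skew α β p₁ p₂
  obtain ⟨ν, h1, h2, h3⟩ := SkewAcip.acip_exists hα hαβ hβ hp₁ hp₂ hp
  refine ⟨ν, ⟨h1, SkewAcip.LL_eq ▸ h2, fun A hA => h3.measure_preimage hA.nullMeasurableSet⟩, ?_⟩
  rintro ν' ⟨h1', h2', h3'⟩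
  refine SkewAcip.acip_unique hα hαβ hβ hp₁ hp₂ hp (SkewAcip.LL_eq ▸ h2') ⟨hS, ?_⟩ h2 h3
  ext A hA
  rw [Measure.map_apply hS hA, h3' A hA]
end
end

section
/- Let 0 < α < β ≤ 1 and p₁, p₂ > 0 with p₁ + p₂ = 1. There exists a Borel probability measure ν on [0,1]×[0,1], absolutely continuous with respect to two-dimensional Lebesgue measure and S-invariant (ν(S⁻¹(A)) = ν(A) for all Borel A), such that the system (S, ν) is mixing: for all Borel sets A, B ⊆ [0,1]×[0,1], lim_{n→∞} ν(S^{−n}(A) ∩ B) = ν(A)·ν(B). -/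
noncomputable section

open Real MeasureTheory Set Filter

/-! ### One-dimensional transfer operators -/

/-- Derivative of the left branch. -/
def dT (γ y : ℝ) : ℝ := 1 + (γ + 1) * (2 ^ γ * y ^ γ)

/-- Inverse of the left branch. -/
def gI (γ x : ℝ) : ℝ := Function.invFunOn (lsvLeft γ) (Icc 0 (1 / 2)) x

/-- Transfer operator of a single LSV map. -/
def Lop (γ : ℝ) (f : ℝ → ℝ) (x : ℝ) : ℝ := f (gI γ x) / dT γ (gI γ x) + f ((x + 1) / 2) / 2

/-- Annealed transfer operator. -/
def Pop (α β p₁ p₂ : ℝ) (f : ℝ → ℝ) (x : ℝ) : ℝ := p₁ * Lop α f x + p₂ * Lop β f x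

/-- Nonnegative decreasing functions with a power bound. -/
structure KK (α a : ℝ) (f : ℝ → ℝ) : Prop where
  nonneg : ∀ x ∈ Ioc (0 : ℝ) 1, 0 ≤ f x
  anti : AntitoneOn f (Ioc (0 : ℝ) 1)
  bd : ∀ x ∈ Ioc (0 : ℝ) 1, f x ≤ a * x ^ (-α)

/-- total mass -/
def mass (f : ℝ → ℝ) : ℝ := ∫ x in Ioc (0 : ℝ) 1, f x

/-- measure with density `f` -/
def mm (f : ℝ → ℝ) : Measure ℝ :=
  (volume.restrict (Ioc (0 : ℝ) 1)).withDensity (fun x => ENNReal.ofReal (f x))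

lemma lsvLeft_strictMonoOn {γ : ℝ} (hγ : 0 < γ) : StrictMonoOn (lsvLeft γ) (Ici 0) := by
  intro x hx y hy hxy
  simp only [mem_Ici] at hx hy
  unfold lsvLeft
  have h1 : x ^ γ ≤ y ^ γ := Real.rpow_le_rpow hx hxy.le hγ.le
  have h2 : (0 : ℝ) < 2 ^ γ := by positivity
  have h3 : 0 ≤ x ^ γ := Real.rpow_nonneg hx _
  have h4 : 2 ^ γ * x ^ γ ≤ 2 ^ γ * y ^ γ := by gcongr
  have h5 : 0 ≤ 2 ^ γ * x ^ γ := by positivity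
  nlinarith

lemma two_rpow_half {γ : ℝ} : (2 : ℝ) ^ γ * (1 / 2 : ℝ) ^ γ = 1 := by
  rw [← Real.mul_rpow (by norm_num) (by norm_num)]; norm_num

lemma u_bounds {γ y : ℝ} (hγ : 0 < γ) (hy : y ∈ Ioc (0 : ℝ) (1 / 2)) :
    0 < (2 : ℝ) ^ γ * y ^ γ ∧ (2 : ℝ) ^ γ * y ^ γ ≤ 1 := by
  have h2 : (0 : ℝ) < 2 ^ γ := by positivity
  refine ⟨by have := hy.1; positivity, ?_⟩
  rw [← two_rpow_half (γ := γ)]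
  gcongr
  · exact hy.1.le
  · exact hy.2

lemma lsvLeft_half {γ : ℝ} : lsvLeft γ (1 / 2) = 1 := by
  unfold lsvLeft; rw [two_rpow_half]; norm_num

lemma lsvLeft_zero {γ : ℝ} : lsvLeft γ 0 = 0 := by
  unfold lsvLeft; simp

lemma lsvLeft_continuous {γ : ℝ} (hγ : 0 < γ) : Continuous (lsvLeft γ) := by
  unfold lsvLeft
  have : Continuous (fun x : ℝ => x ^ γ) := Real.continuous_rpow_const hγ.le
  fun_prop

lemma gI_exists {γ x : ℝ} (hγ : 0 < γ) (hx : x ∈ Ioc (0 : ℝ) 1) :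
    ∃ y ∈ Icc (0 : ℝ) (1 / 2), lsvLeft γ y = x := by
  have := intermediate_value_Icc (by norm_num : (0 : ℝ) ≤ 1 / 2)
    (lsvLeft_continuous hγ).continuousOn
  rw [lsvLeft_zero, lsvLeft_half] at this
  exact this ⟨hx.1.le, hx.2⟩

lemma gI_eq {γ x : ℝ} (hγ : 0 < γ) (hx : x ∈ Ioc (0 : ℝ) 1) : lsvLeft γ (gI γ x) = x :=
  Function.invFunOn_eq (gI_exists hγ hx)

lemma gI_mem {γ x : ℝ} (hγ : 0 < γ) (hx : x ∈ Ioc (0 : ℝ) 1) : gI γ x ∈ Ioc (0 : ℝ) (1 / 2) := by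
  have h := Function.invFunOn_mem (gI_exists hγ hx)
  have h' := gI_eq hγ hx
  refine ⟨lt_of_le_of_ne h.1 ?_, h.2⟩
  intro h0
  rw [← h0, lsvLeft_zero] at h'
  exact hx.1.ne h'

lemma gI_mem' {γ x : ℝ} (hγ : 0 < γ) (hx : x ∈ Ioc (0 : ℝ) 1) : gI γ x ∈ Ioc (0 : ℝ) 1 := by
  have := gI_mem hγ hx
  exact ⟨this.1, by linarith [this.2]⟩

lemma half_mem {x : ℝ} (hx : x ∈ Ioc (0 : ℝ) 1) : (x + 1) / 2 ∈ Ioc (0 : ℝ) 1 :=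
  ⟨by linarith [hx.1], by linarith [hx.2]⟩

lemma gI_mono {γ : ℝ} (hγ : 0 < γ) : MonotoneOn (gI γ) (Ioc 0 1) := by
  intro x hx y hy hxy
  have h1 := gI_mem hγ hx
  have h2 := gI_mem hγ hy
  rw [← (lsvLeft_strictMonoOn hγ).le_iff_le h1.1.le h2.1.le, gI_eq hγ hx, gI_eq hγ hy]
  exact hxy

lemma lsvLeft_mem {γ y : ℝ} (hγ : 0 < γ) (hy : y ∈ Ioc (0 : ℝ) (1 / 2)) :
    lsvLeft γ y ∈ Ioc (0 : ℝ) 1 := by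
  have hm := lsvLeft_strictMonoOn hγ
  constructor
  · rw [← lsvLeft_zero (γ := γ)]
    exact hm (by simp) hy.1.le hy.1
  · rw [← lsvLeft_half (γ := γ)]
    exact hm.monotoneOn hy.1.le (by simp) hy.2

lemma gI_lsvLeft {γ y : ℝ} (hγ : 0 < γ) (hy : y ∈ Ioc (0 : ℝ) (1 / 2)) :
    gI γ (lsvLeft γ y) = y := by
  have h := lsvLeft_mem hγ hy
  exact (lsvLeft_strictMonoOn hγ).injOn (gI_mem hγ h).1.le hy.1.le (gI_eq hγ h)

lemma dT_ge_one {γ y : ℝ} (hγ : 0 < γ) (hy : 0 ≤ y) : 1 ≤ dT γ y := by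
  unfold dT
  have : 0 ≤ (γ + 1) * ((2 : ℝ) ^ γ * y ^ γ) := by positivity
  linarith

lemma dT_mono {γ x y : ℝ} (hγ : 0 < γ) (hx : 0 ≤ x) (hxy : x ≤ y) : dT γ x ≤ dT γ y := by
  unfold dT; gcongr

lemma hasDerivAt_lsvLeft {γ y : ℝ} (hy : 0 < y) :
    HasDerivAt (lsvLeft γ) (dT γ y) y := by
  have h1 : HasDerivAt (fun x : ℝ => x ^ γ) (γ * y ^ (γ - 1)) y :=
    Real.hasDerivAt_rpow_const (Or.inl hy.ne')
  have h2 := (hasDerivAt_id y).mul ((h1.const_mul ((2 : ℝ) ^ γ)).const_add 1)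
  have h3 : y * y ^ (γ - 1) = y ^ γ := by
    rw [mul_comm, ← Real.rpow_add_one hy.ne']; simp
  refine HasDerivAt.congr_deriv (f := lsvLeft γ) h2 ?_
  simp only [id, dT]
  rw [← h3]; ring

lemma aemeas_of_anti {f : ℝ → ℝ} (hf : AntitoneOn f (Ioc (0 : ℝ) 1)) :
    AEMeasurable f (volume.restrict (Ioc (0 : ℝ) 1)) :=
  aemeasurable_restrict_of_antitoneOn measurableSet_Ioc hf

lemma integrable_rpow_neg {α : ℝ} (hα1 : α < 1) :
    IntegrableOn (fun x : ℝ => x ^ (-α)) (Ioc 0 1) := by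
  rw [← intervalIntegrable_iff_integrableOn_Ioc_of_le zero_le_one]
  exact intervalIntegral.intervalIntegrable_rpow' (by linarith)

lemma KK.integrable {α a : ℝ} {f : ℝ → ℝ} (hα1 : α < 1) (hf : KK α a f) :
    IntegrableOn f (Ioc 0 1) := by
  refine Integrable.mono' ((integrable_rpow_neg hα1).const_mul a)
    (aemeas_of_anti hf.anti).aestronglyMeasurable ?_
  filter_upwards [ae_restrict_mem measurableSet_Ioc] with x hx
  rw [Real.norm_of_nonneg (hf.nonneg x hx)]
  exact hf.bd x hx

lemma KK.mass_nonneg {α a : ℝ} {f : ℝ → ℝ} (hf : KK α a f) : 0 ≤ mass f :=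
  setIntegral_nonneg measurableSet_Ioc hf.nonneg

lemma mm_univ {α a : ℝ} {f : ℝ → ℝ} (hα1 : α < 1) (hf : KK α a f) :
    mm f univ = ENNReal.ofReal (mass f) := by
  unfold mm mass
  rw [withDensity_apply _ MeasurableSet.univ, Measure.restrict_univ,
    ofReal_integral_eq_lintegral_ofReal (hf.integrable hα1)]
  filter_upwards [ae_restrict_mem measurableSet_Ioc] with x hx using hf.nonneg x hx

lemma mm_congr {f g : ℝ → ℝ} (h : EqOn f g (Ioc 0 1)) : mm f = mm g := by
  unfold mm
  apply withDensity_congr_ae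
  filter_upwards [ae_restrict_mem measurableSet_Ioc] with x hx
  rw [h hx]

lemma Lop_anti {γ : ℝ} (hγ : 0 < γ) {f : ℝ → ℝ} (h0 : ∀ x ∈ Ioc (0 : ℝ) 1, 0 ≤ f x)
    (hf : AntitoneOn f (Ioc (0 : ℝ) 1)) :
    AntitoneOn (fun x => f (gI γ x) / dT γ (gI γ x)) (Ioc 0 1) ∧
    AntitoneOn (fun x => f ((x + 1) / 2) / 2) (Ioc 0 1) := by
  constructor
  · intro x hx y hy hxy
    have h1 := gI_mono hγ hx hy hxy
    have h2 := gI_mem' hγ hx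
    have h3 := gI_mem' hγ hy
    have h4 := dT_ge_one hγ h2.1.le
    have h5 := dT_mono hγ h2.1.le h1
    exact div_le_div₀ (h0 _ h2) (hf h2 h3 h1) (by linarith) h5
  · intro x hx y hy hxy
    have := hf (half_mem hx) (half_mem hy) (by linarith)
    simp only
    linarith

lemma lsv_measurable (γ : ℝ) : Measurable (lsv γ) := by
  unfold lsv
  refine Measurable.ite measurableSet_Iic ?_ ?_ <;> fun_prop

lemma map_mm {γ : ℝ} (hγ : 0 < γ) {f : ℝ → ℝ} (h0 : ∀ x ∈ Ioc (0 : ℝ) 1, 0 ≤ f x)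
    (hf : AntitoneOn f (Ioc (0 : ℝ) 1)) : (mm f).map (lsv γ) = mm (Lop γ f) := by
  ext A hA
  rw [Measure.map_apply (lsv_measurable γ) hA]
  unfold mm
  rw [withDensity_apply _ (lsv_measurable γ hA), withDensity_apply _ hA,
    Measure.restrict_restrict (lsv_measurable γ hA), Measure.restrict_restrict hA]
  have hs1 : MeasurableSet (Ioc (0 : ℝ) (1 / 2) ∩ lsv γ ⁻¹' A) :=
    measurableSet_Ioc.inter (lsv_measurable γ hA)
  have hs2 : MeasurableSet (Ioc (1 / 2 : ℝ) 1 ∩ lsv γ ⁻¹' A) :=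
    measurableSet_Ioc.inter (lsv_measurable γ hA)
  have hsplit : lsv γ ⁻¹' A ∩ Ioc 0 1 =
      (Ioc (0 : ℝ) (1 / 2) ∩ lsv γ ⁻¹' A) ∪ (Ioc (1 / 2 : ℝ) 1 ∩ lsv γ ⁻¹' A) := by
    rw [← union_inter_distrib_right, Ioc_union_Ioc_eq_Ioc (by norm_num) (by norm_num), inter_comm]
  rw [hsplit, lintegral_union hs2 (by
    rw [Set.disjoint_left]; rintro x ⟨hx, _⟩ ⟨hx', _⟩; exact absurd hx.2 (not_le.2 hx'.1))]
  have hl : ∀ x ∈ Ioc (0 : ℝ) (1 / 2), lsv γ x = lsvLeft γ x := by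
    intro x hx; unfold lsv lsvLeft; rw [if_pos hx.2]
  have hr : ∀ x ∈ Ioc (1 / 2 : ℝ) 1, lsv γ x = 2 * x - 1 := by
    intro x hx; unfold lsv; rw [if_neg (not_le.2 hx.1)]
  have him1 : lsvLeft γ '' (Ioc (0 : ℝ) (1 / 2) ∩ lsv γ ⁻¹' A) = A ∩ Ioc 0 1 := by
    ext z; constructor
    · rintro ⟨x, ⟨hx, hxA⟩, rfl⟩
      rw [mem_preimage, hl x hx] at hxA
      exact ⟨hxA, lsvLeft_mem hγ hx⟩
    · rintro ⟨hzA, hz⟩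
      refine ⟨gI γ z, ⟨gI_mem hγ hz, ?_⟩, gI_eq hγ hz⟩
      rw [mem_preimage, hl _ (gI_mem hγ hz), gI_eq hγ hz]; exact hzA
  have him2 : (fun x : ℝ => 2 * x - 1) '' (Ioc (1 / 2 : ℝ) 1 ∩ lsv γ ⁻¹' A) = A ∩ Ioc 0 1 := by
    ext z; constructor
    · rintro ⟨x, ⟨hx, hxA⟩, rfl⟩
      rw [mem_preimage, hr x hx] at hxA
      exact ⟨hxA, by linarith [hx.1], by linarith [hx.2]⟩
    · rintro ⟨hzA, hz⟩
      have hm : (z + 1) / 2 ∈ Ioc (1 / 2 : ℝ) 1 := ⟨by linarith [hz.1], by linarith [hz.2]⟩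
      refine ⟨(z + 1) / 2, ⟨hm, ?_⟩, by simp only; ring⟩
      rw [mem_preimage, hr _ hm]
      convert hzA using 1; ring
  have c1 := lintegral_image_eq_lintegral_abs_deriv_mul hs1
    (fun x hx => (hasDerivAt_lsvLeft (γ := γ) hx.1.1).hasDerivWithinAt)
    (((lsvLeft_strictMonoOn hγ).injOn).mono (fun x hx => hx.1.1.le))
    (fun x => ENNReal.ofReal (f (gI γ x) / dT γ (gI γ x)))
  have c2 := lintegral_image_eq_lintegral_abs_deriv_mul (f := fun x : ℝ => 2 * x - 1)
    (f' := fun _ => 2) hs2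
    (fun x hx => by
      have := ((hasDerivAt_id x).const_mul (2 : ℝ)).sub_const 1
      simpa using this.hasDerivWithinAt)
    (by intro x _ y _ hxy; simp only at hxy; linarith)
    (fun x => ENNReal.ofReal (f ((x + 1) / 2) / 2))
  rw [him1] at c1
  rw [him2] at c2
  have e1 : ∫⁻ x in Ioc (0 : ℝ) (1 / 2) ∩ lsv γ ⁻¹' A, ENNReal.ofReal |dT γ x| *
      ENNReal.ofReal (f (gI γ (lsvLeft γ x)) / dT γ (gI γ (lsvLeft γ x)))
      = ∫⁻ x in Ioc (0 : ℝ) (1 / 2) ∩ lsv γ ⁻¹' A, ENNReal.ofReal (f x) := by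
    apply setLIntegral_congr_fun hs1
    intro x hx
    have hd := dT_ge_one hγ hx.1.1.le
    simp only
    rw [gI_lsvLeft hγ hx.1, ← ENNReal.ofReal_mul (abs_nonneg _), abs_of_pos (by linarith)]
    congr 1
    field_simp
  have e2 : ∫⁻ x in Ioc (1 / 2 : ℝ) 1 ∩ lsv γ ⁻¹' A, ENNReal.ofReal |(2 : ℝ)| *
      ENNReal.ofReal (f ((2 * x - 1 + 1) / 2) / 2)
      = ∫⁻ x in Ioc (1 / 2 : ℝ) 1 ∩ lsv γ ⁻¹' A, ENNReal.ofReal (f x) := by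
    apply setLIntegral_congr_fun hs2
    intro x hx
    simp only
    rw [← ENNReal.ofReal_mul (abs_nonneg _), abs_of_pos (by norm_num)]
    congr 1
    rw [show (2 * x - 1 + 1) / 2 = x by ring]; ring
  rw [e1] at c1
  rw [e2] at c2
  rw [← c1, ← c2]
  have hanti := Lop_anti hγ h0 hf
  rw [← lintegral_add_left']
  · apply setLIntegral_congr_fun (hA.inter measurableSet_Ioc)
    intro x hx
    simp only
    unfold Lop
    have hg := gI_mem' hγ hx.2
    rw [ENNReal.ofReal_add]
    · exact div_nonneg (h0 _ hg) (by linarith [dT_ge_one hγ hg.1.le])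
    · exact div_nonneg (h0 _ (half_mem hx.2)) (by norm_num)
  · exact ((aemeas_of_anti hanti.1).ennreal_ofReal).mono_measure
      (Measure.restrict_mono inter_subset_right le_rfl)

/-! ### The invariant cone -/

lemma rpow_est {α γ y x : ℝ} (hα : 0 < α) (hα1 : α < 1) (hγ : 0 < γ)
    (hy : y ∈ Ioc (0 : ℝ) (1 / 2)) (hxy : lsvLeft γ y = x) :
    y ^ (-α) ≤ x ^ (-α) * (1 + α * (2 ^ γ * y ^ γ)) := by
  obtain ⟨hu0, hu1⟩ := u_bounds hγ hy
  set u := (2 : ℝ) ^ γ * y ^ γ with hu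
  have hx : x = y * (1 + u) := by rw [← hxy]; rfl
  rw [hx, Real.mul_rpow hy.1.le (by linarith), mul_assoc]
  have h1 : (1 + u) ^ α ≤ 1 + α * u :=
    rpow_one_add_le_one_add_mul_self (by linarith) hα.le hα1.le
  have h2 : (1 + u) ^ (-α) * (1 + u) ^ α = 1 := by
    rw [← Real.rpow_add (by linarith)]; simp
  have h3 : 0 ≤ (1 + u) ^ (-α) := Real.rpow_nonneg (by linarith) _
  have h4 : 0 ≤ y ^ (-α) := Real.rpow_nonneg hy.1.le _
  have h5 : 1 ≤ (1 + u) ^ (-α) * (1 + α * u) := by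
    exact h2.symm.le.trans (mul_le_mul_of_nonneg_left h1 h3)
  nlinarith

lemma left_bd {α γ x : ℝ} (hα : 0 < α) (hα1 : α < 1) (hγ : 0 < γ) (hx : x ∈ Ioc (0 : ℝ) 1) :
    (gI γ x) ^ (-α) / dT γ (gI γ x) ≤ x ^ (-α) := by
  have hy := gI_mem hγ hx
  have h := rpow_est hα hα1 hγ hy (gI_eq hγ hx)
  have hd := dT_ge_one hγ hy.1.le
  rw [div_le_iff₀ (by linarith)]
  refine h.trans ?_
  have h0 : 0 ≤ x ^ (-α) := Real.rpow_nonneg hx.1.le _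
  have hu := (u_bounds hγ hy).1
  apply mul_le_mul_of_nonneg_left _ h0
  unfold dT
  nlinarith

lemma left_bd' {α x : ℝ} (hα : 0 < α) (hα1 : α < 1) (hx : x ∈ Ioc (0 : ℝ) 1) :
    (gI α x) ^ (-α) / dT α (gI α x) ≤ x ^ (-α) - 1 / 3 := by
  have hy := gI_mem hα hx
  have h := rpow_est hα hα1 hα hy (gI_eq hα hx)
  have hd := dT_ge_one hα hy.1.le
  rw [div_le_iff₀ (by linarith)]
  refine h.trans ?_
  have h0 : 0 < x ^ (-α) := Real.rpow_pos_of_pos hx.1 _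
  obtain ⟨hu, hu1⟩ := u_bounds hα hy
  have hxu : x ≤ 2 * gI α x := by
    have := gI_eq hα hx
    unfold lsvLeft at this
    nlinarith [hy.1]
  have hk : 1 ≤ x ^ (-α) * (2 ^ α * (gI α x) ^ α) := by
    rw [← Real.mul_rpow (by norm_num) hy.1.le]
    have : x ^ α ≤ (2 * gI α x) ^ α := Real.rpow_le_rpow hx.1.le hxu hα.le
    calc (1 : ℝ) = x ^ (-α) * x ^ α := by rw [← Real.rpow_add hx.1]; simp
      _ ≤ _ := by gcongr
  unfold dT
  set u := (2 : ℝ) ^ α * (gI α x) ^ α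
  nlinarith

lemma KK.a_nonneg {α a : ℝ} {f : ℝ → ℝ} (hf : KK α a f) : 0 ≤ a := by
  have h1 := hf.nonneg 1 (by simp)
  have h2 := hf.bd 1 (by simp)
  simp at h2; linarith

lemma one_le_rpow_neg {α x : ℝ} (hα : 0 < α) (hx : x ∈ Ioc (0 : ℝ) 1) : 1 ≤ x ^ (-α) :=
  Real.one_le_rpow_of_pos_of_le_one_of_nonpos hx.1 hx.2 (by linarith)

lemma KK.mono {α a b : ℝ} {f : ℝ → ℝ} (hf : KK α a f) (hab : a ≤ b) : KK α b f :=
  ⟨hf.nonneg, hf.anti, fun x hx => (hf.bd x hx).trans (by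
    have : 0 ≤ x ^ (-α) := Real.rpow_nonneg hx.1.le _
    gcongr)⟩

lemma KK.Lop {α γ a : ℝ} {f : ℝ → ℝ} (hα : 0 < α) (hα1 : α < 1) (hγ : 0 < γ) (hf : KK α a f) :
    KK α (2 * a) (Lop γ f) := by
  have hA := Lop_anti hγ hf.nonneg hf.anti
  have ha := hf.a_nonneg
  refine ⟨fun x hx => ?_, fun x hx y hy hxy => add_le_add (hA.1 hx hy hxy) (hA.2 hx hy hxy),
    fun x hx => ?_⟩
  · have hg := gI_mem' hγ hx
    exact add_nonneg (div_nonneg (hf.nonneg _ hg) (by linarith [dT_ge_one hγ hg.1.le]))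
      (div_nonneg (hf.nonneg _ (half_mem hx)) (by norm_num))
  · unfold _root_.Lop
    have hg := gI_mem' hγ hx
    have hd := dT_ge_one hγ hg.1.le
    have h1 : f (gI γ x) / dT γ (gI γ x) ≤ a * x ^ (-α) := by
      calc f (gI γ x) / dT γ (gI γ x) ≤ (a * (gI γ x) ^ (-α)) / dT γ (gI γ x) := by
            gcongr
            exact hf.bd _ hg
        _ = a * ((gI γ x) ^ (-α) / dT γ (gI γ x)) := by ring
        _ ≤ _ := by gcongr; exact left_bd hα hα1 hγ hx
    have h2 : f ((x + 1) / 2) ≤ f x := hf.anti hx (half_mem hx) (by linarith [hx.2])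
    have h3 := hf.bd x hx
    have h4 := hf.nonneg x hx
    linarith

lemma mass_Lop {α γ a : ℝ} {f : ℝ → ℝ} (hα : 0 < α) (hα1 : α < 1) (hγ : 0 < γ) (hf : KK α a f) :
    mass (Lop γ f) = mass f := by
  have h := map_mm hγ hf.nonneg hf.anti
  have h2 := congrArg (fun m => m univ) h
  rw [Measure.map_apply (lsv_measurable γ) MeasurableSet.univ, preimage_univ, mm_univ hα1 hf,
    mm_univ hα1 (hf.Lop hα hα1 hγ)] at h2
  exact ((ENNReal.ofReal_eq_ofReal_iff hf.mass_nonneg (hf.Lop hα hα1 hγ).mass_nonneg).1 h2).symm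

lemma KK.le_mass_div {α a : ℝ} {f : ℝ → ℝ} (hα1 : α < 1) (hf : KK α a f) {x : ℝ}
    (hx : x ∈ Ioc (0 : ℝ) 1) : f x ≤ mass f / x := by
  rw [le_div_iff₀ hx.1]
  have hsub : Ioc 0 x ⊆ Ioc (0 : ℝ) 1 := Ioc_subset_Ioc_right hx.2
  calc f x * x = ∫ _ in Ioc 0 x, f x := by
        simp [hx.1.le, mul_comm]
    _ ≤ ∫ t in Ioc 0 x, f t := by
        apply setIntegral_mono_on (by simp) ((hf.integrable hα1).mono_set hsub) measurableSet_Ioc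
        intro t ht
        exact hf.anti (hsub ht) hx ht.2
    _ ≤ mass f := by
        apply setIntegral_mono_set (hf.integrable hα1) _ hsub.eventuallyLE
        filter_upwards [ae_restrict_mem measurableSet_Ioc] with x hx using hf.nonneg x hx

/-- The cone with matching mass. -/
structure Cn (α p₁ a m : ℝ) (f : ℝ → ℝ) : Prop extends KK α a f where
  ms : mass f = m
  le : m ≤ p₁ * a / 3

set_option linter.unusedSectionVars false

section cone
lemma Cn.Pop {α β p₁ p₂ : ℝ} (hα : 0 < α) (hα1 : α < 1) (hβ : 0 < β) (hp₁ : 0 < p₁) (hp₂ : 0 < p₂)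
    (hp : p₁ + p₂ = 1)
    {a m : ℝ} {f : ℝ → ℝ} (hf : Cn α p₁ a m f) :
    Cn α p₁ a m (Pop α β p₁ p₂ f) := by
  have k := hf.toKK
  have k1 := k.Lop hα hα1 hα
  have k2 := k.Lop hα hα1 hβ
  have ha := k.a_nonneg
  refine ⟨⟨fun x hx => ?_, fun x hx y hy hxy => ?_, fun x hx => ?_⟩, ?_, hf.le⟩
  · have := k1.nonneg x hx
    have := k2.nonneg x hx
    unfold _root_.Pop
    positivity
  · have := k1.anti hx hy hxy
    have := k2.anti hx hy hxy
    unfold _root_.Pop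
    gcongr
  · have est : ∀ γ : ℝ, 0 < γ → ∀ B : ℝ, (gI γ x) ^ (-α) / dT γ (gI γ x) ≤ B →
        Lop γ f x ≤ a * B + m := by
      intro γ hγ B hB
      have hg := gI_mem' hγ hx
      have hd := dT_ge_one hγ hg.1.le
      have h1 : f (gI γ x) / dT γ (gI γ x) ≤ a * B := by
        calc f (gI γ x) / dT γ (gI γ x) ≤ (a * (gI γ x) ^ (-α)) / dT γ (gI γ x) := by
              gcongr
              exact k.bd _ hg
          _ = a * ((gI γ x) ^ (-α) / dT γ (gI γ x)) := by ring
          _ ≤ _ := by gcongr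
      have h2 := k.le_mass_div hα1 (half_mem hx)
      have h3 : mass f / ((x + 1) / 2) ≤ 2 * m := by
        rw [hf.ms, div_le_iff₀ (half_mem hx).1]
        have : 0 ≤ m := by rw [← hf.ms]; exact k.mass_nonneg
        nlinarith [hx.1]
      unfold _root_.Lop
      linarith
    have e1 := est α hα _ (left_bd' hα hα1 hx)
    have e2 := est β hβ _ (left_bd hα hα1 hβ hx)
    have e3 := mul_le_mul_of_nonneg_left e1 hp₁.le
    have e4 := mul_le_mul_of_nonneg_left e2 hp₂.le
    have hle := hf.le
    unfold _root_.Pop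
    have hp2 : p₂ = 1 - p₁ := by linarith
    subst hp2
    nlinarith
  · have i1 := (k1.integrable hα1).const_mul p₁
    have i2 := (k2.integrable hα1).const_mul p₂
    have m1 := mass_Lop hα hα1 hα k
    have m2 := mass_Lop hα hα1 hβ k
    have := integral_add i1 i2
    rw [integral_const_mul, integral_const_mul] at this
    unfold mass at m1 m2
    rw [m1, m2, ← add_mul, hp, one_mul] at this
    rw [← hf.ms]
    exact this

lemma Cn.iter {α β p₁ p₂ : ℝ} (hα : 0 < α) (hα1 : α < 1) (hβ : 0 < β) (hp₁ : 0 < p₁) (hp₂ : 0 < p₂)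
    (hp : p₁ + p₂ = 1)
    {a m : ℝ} {f : ℝ → ℝ} (hf : Cn α p₁ a m f) (n : ℕ) :
    Cn α p₁ a m ((_root_.Pop α β p₁ p₂)^[n] f) := by
  induction n with
  | zero => exact hf
  | succ n ih =>
    rw [Function.iterate_succ_apply']
    exact ih.Pop hα hα1 hβ hp₁ hp₂ hp

lemma exists_t {α : ℝ} (hα : 0 < α) (hα1 : α < 1)
    (a ε : ℝ) (hε : 0 < ε) : ∃ t ∈ Ioc (0 : ℝ) 1, ∀ f, KK α a f → ε ≤ mass f →
    ε / 2 ≤ f t := by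
  have hc : Tendsto (fun t : ℝ => a * (t ^ (1 - α) / (1 - α))) (nhdsWithin 0 (Ioi 0)) (nhds 0) := by
    have : Continuous (fun t : ℝ => a * (t ^ (1 - α) / (1 - α))) := by
      have := Real.continuous_rpow_const (q := 1 - α) (by linarith)
      fun_prop
    have h := (this.tendsto 0).mono_left (nhdsWithin_le_nhds (s := Ioi 0))
    simpa [Real.zero_rpow (by linarith : 1 - α ≠ 0)] using h
  have h1 := hc.eventually (gt_mem_nhds (half_pos hε))
  have h2 : ∀ᶠ t : ℝ in nhdsWithin 0 (Ioi 0), t ∈ Ioc (0 : ℝ) 1 :=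
    Ioc_mem_nhdsGT one_pos
  obtain ⟨t, ht, htm⟩ := (h1.and h2).exists
  refine ⟨t, htm, fun f hf hm => ?_⟩
  have hi := hf.integrable hα1
  have hsub1 : Ioc 0 t ⊆ Ioc (0 : ℝ) 1 := Ioc_subset_Ioc_right htm.2
  have hsub2 : Ioc t 1 ⊆ Ioc (0 : ℝ) 1 := Ioc_subset_Ioc_left htm.1.le
  have hsplit : mass f = (∫ x in Ioc 0 t, f x) + ∫ x in Ioc t 1, f x := by
    unfold mass
    rw [← setIntegral_union (by
      rw [Set.disjoint_left]; intro x hx hx'; exact absurd hx.2 (not_le.2 hx'.1)) measurableSet_Ioc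
      (hi.mono_set hsub1) (hi.mono_set hsub2), Ioc_union_Ioc_eq_Ioc htm.1.le htm.2]
  have b1 : ∫ x in Ioc 0 t, f x ≤ a * (t ^ (1 - α) / (1 - α)) := by
    calc ∫ x in Ioc 0 t, f x ≤ ∫ x in Ioc 0 t, a * x ^ (-α) := by
          apply setIntegral_mono_on (hi.mono_set hsub1)
            (IntegrableOn.mono_set ((integrable_rpow_neg hα1).const_mul a) hsub1) measurableSet_Ioc
          intro x hx
          exact hf.bd x (hsub1 hx)
      _ = a * (t ^ (1 - α) / (1 - α)) := by
          rw [integral_const_mul, ← intervalIntegral.integral_of_le htm.1.le,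
            integral_rpow (Or.inl (by linarith))]
          rw [Real.zero_rpow (by linarith)]
          rw [show -α + 1 = 1 - α by ring, sub_zero]
  have b2 : ∫ x in Ioc t 1, f x ≤ f t * (1 - t) := by
    calc ∫ x in Ioc t 1, f x ≤ ∫ _ in Ioc t 1, f t := by
          apply setIntegral_mono_on (hi.mono_set hsub2) (by simp) measurableSet_Ioc
          intro x hx
          exact hf.anti htm (hsub2 hx) hx.1.le
      _ = f t * (1 - t) := by simp [htm.2, mul_comm]
  have h0 := hf.nonneg t htm
  nlinarith [htm.1]

lemma grow {α β p₁ p₂ : ℝ} (hα : 0 < α) (hα1 : α < 1) (hβ : 0 < β) (hp₁ : 0 < p₁) (hp₂ : 0 < p₂)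
    (hp : p₁ + p₂ = 1)
    {t a m : ℝ} {f : ℝ → ℝ} (ht : t ∈ Ioc (0 : ℝ) 1) (hf : Cn α p₁ a m f) (k : ℕ) :
    (p₁ / 3) ^ k * f t ≤ (_root_.Pop α β p₁ p₂)^[k] f (min 1 (t * (1 + 2 ^ α * t ^ α) ^ k)) := by
  have hr : 1 ≤ 1 + (2 : ℝ) ^ α * t ^ α := by
    have := ht.1
    have : 0 ≤ (2 : ℝ) ^ α * t ^ α := by positivity
    linarith
  have hmem : ∀ k : ℕ, min 1 (t * (1 + 2 ^ α * t ^ α) ^ k) ∈ Ioc (0 : ℝ) 1 := by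
    intro k
    refine ⟨lt_min one_pos (mul_pos ht.1 (by positivity)), min_le_left _ _⟩
  induction k with
  | zero => simp [min_eq_right ht.2]
  | succ k ih =>
    rw [Function.iterate_succ_apply']
    have hc := hf.iter hα hα1 hβ hp₁ hp₂ hp k
    set F := (_root_.Pop α β p₁ p₂)^[k] f with hF
    set s := min 1 (t * (1 + 2 ^ α * t ^ α) ^ k) with hs
    set s' := min 1 (t * (1 + 2 ^ α * t ^ α) ^ (k + 1)) with hs'
    have ms := hmem k
    have ms' := hmem (k + 1)
    have hg := gI_mem hα ms'
    have hg' := gI_mem' hα ms'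
    have hys : gI α s' ≤ s := by
      by_contra hcon
      push Not at hcon
      have hlt : t * (1 + 2 ^ α * t ^ α) ^ k < 1 := by
        by_contra h1
        push Not at h1
        rw [hs, min_eq_left h1] at hcon
        linarith [hg.2]
      rw [hs, min_eq_right hlt.le] at hcon
      have hts : t < gI α s' := by
        refine lt_of_le_of_lt ?_ hcon
        exact le_mul_of_one_le_right ht.1.le (one_le_pow₀ hr)
      have e := gI_eq hα ms'
      unfold lsvLeft at e
      have h3 : t ^ α ≤ (gI α s') ^ α := Real.rpow_le_rpow ht.1.le hts.le hα.le
      have h4 : (1 : ℝ) + 2 ^ α * t ^ α ≤ 1 + 2 ^ α * (gI α s') ^ α := by gcongr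
      have h5 : s' ≤ t * (1 + 2 ^ α * t ^ α) ^ (k + 1) := min_le_right _ _
      have h6 : t * (1 + 2 ^ α * t ^ α) ^ k * (1 + 2 ^ α * t ^ α) <
          gI α s' * (1 + 2 ^ α * (gI α s') ^ α) :=
        mul_lt_mul hcon h4 (by linarith) hg.1.le
      rw [e] at h6
      rw [pow_succ, ← mul_assoc] at h5
      linarith
    have hFs := hc.anti hg' ms hys
    have hd1 := dT_ge_one hα hg.1.le
    have hd3 : dT α (gI α s') ≤ 3 := by
      have := u_bounds hα hg
      unfold dT
      nlinarith
    have hFn := hc.nonneg _ hg'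
    have l1 : F s / 3 ≤ F (gI α s') / dT α (gI α s') := by
      have := hc.nonneg _ ms
      apply div_le_div₀ hFn hFs (by linarith) hd3
    have l2 := hc.nonneg _ (half_mem ms')
    have l3 := (hc.toKK.Lop hα hα1 hβ).nonneg _ ms'
    calc (p₁ / 3) ^ (k + 1) * f t = p₁ / 3 * ((p₁ / 3) ^ k * f t) := by ring
      _ ≤ p₁ / 3 * F s := by gcongr
      _ = p₁ * (F s / 3) := by ring
      _ ≤ p₁ * Lop α F s' := by
          unfold Lop
          gcongr
          linarith
      _ ≤ _ := by
          unfold _root_.Pop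
          have : 0 ≤ p₂ * Lop β F s' := by positivity
          linarith

lemma exists_lower {α β p₁ p₂ : ℝ} (hα : 0 < α) (hα1 : α < 1) (hβ : 0 < β) (hp₁ : 0 < p₁) (hp₂ : 0 < p₂)
    (hp : p₁ + p₂ = 1)
    (a ε : ℝ) (hε : 0 < ε) : ∃ N : ℕ, ∃ η : ℝ, 0 < η ∧ ∀ f m, Cn α p₁ a m f →
    ε ≤ m → ∀ x ∈ Ioc (0 : ℝ) 1, η ≤ (_root_.Pop α β p₁ p₂)^[N] f x := by
  obtain ⟨t, ht, h⟩ := exists_t hα hα1 a ε hε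
  have hr : 1 < 1 + (2 : ℝ) ^ α * t ^ α := by
    have := ht.1
    have : 0 < (2 : ℝ) ^ α * t ^ α := by positivity
    linarith
  obtain ⟨N, hN⟩ := pow_unbounded_of_one_lt (1 / t) hr
  refine ⟨N, (p₁ / 3) ^ N * (ε / 2), by positivity, fun f m hf hm x hx => ?_⟩
  have h1 := grow hα hα1 hβ hp₁ hp₂ hp ht hf N
  have h2 := h f hf.toKK (by rw [hf.ms]; exact hm)
  rw [min_eq_left] at h1
  · have h3 := (hf.iter hα hα1 hβ hp₁ hp₂ hp N).anti hx (by simp) hx.2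
    refine le_trans ?_ (h1.trans h3)
    gcongr
  · rw [div_lt_iff₀ ht.1] at hN
    linarith

lemma Pop_sub {α β p₁ p₂ : ℝ} (hα : 0 < α) (hα1 : α < 1) (hβ : 0 < β) (hp₁ : 0 < p₁) (hp₂ : 0 < p₂)
    (hp : p₁ + p₂ = 1)
    (f g : ℝ → ℝ) : _root_.Pop α β p₁ p₂ f - _root_.Pop α β p₁ p₂ g =
    _root_.Pop α β p₁ p₂ (f - g) := by
  funext x
  simp only [_root_.Pop, Lop, Pi.sub_apply]
  ring

lemma iter_sub {α β p₁ p₂ : ℝ} (hα : 0 < α) (hα1 : α < 1) (hβ : 0 < β) (hp₁ : 0 < p₁) (hp₂ : 0 < p₂)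
    (hp : p₁ + p₂ = 1)
    (f g : ℝ → ℝ) (n : ℕ) :
    (_root_.Pop α β p₁ p₂)^[n] f - (_root_.Pop α β p₁ p₂)^[n] g =
    (_root_.Pop α β p₁ p₂)^[n] (f - g) := by
  induction n with
  | zero => rfl
  | succ n ih =>
    rw [Function.iterate_succ_apply', Function.iterate_succ_apply', Function.iterate_succ_apply',
      ← ih, Pop_sub hα hα1 hβ hp₁ hp₂ hp]

lemma Cn.sub_const {α β p₁ p₂ : ℝ} (hα : 0 < α) (hα1 : α < 1) (hβ : 0 < β) (hp₁ : 0 < p₁) (hp₂ : 0 < p₂)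
    (hp : p₁ + p₂ = 1)
    {a m η : ℝ} {f : ℝ → ℝ} (hη : 0 < η) (hf : Cn α p₁ a m f)
    (h : ∀ x ∈ Ioc (0 : ℝ) 1, η ≤ f x) : Cn α p₁ a (m - η) (fun x => f x - η) := by
  refine ⟨⟨fun x hx => by linarith [h x hx], fun x hx y hy hxy => ?_, fun x hx => ?_⟩, ?_, ?_⟩
  · have := hf.anti hx hy hxy
    linarith
  · have := hf.bd x hx
    linarith
  · unfold mass
    rw [integral_sub (hf.toKK.integrable hα1) (by simp)]
    have := hf.ms
    unfold mass at this
    rw [this]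
    simp
  · linarith [hf.le]

lemma coupling {α β p₁ p₂ : ℝ} (hα : 0 < α) (hα1 : α < 1) (hβ : 0 < β) (hp₁ : 0 < p₁) (hp₂ : 0 < p₂)
    (hp : p₁ + p₂ = 1)
    (a ε : ℝ) (hε : 0 < ε) : ∃ M : ℕ, ∀ f g m, Cn α p₁ a m f → Cn α p₁ a m g →
    ∃ f' g' m', Cn α p₁ a m' f' ∧ Cn α p₁ a m' g' ∧ m' ≤ ε ∧
      (_root_.Pop α β p₁ p₂)^[M] f - (_root_.Pop α β p₁ p₂)^[M] g = f' - g' := by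
  obtain ⟨N, η, hη, hlow⟩ := exists_lower hα hα1 hβ hp₁ hp₂ hp a ε hε
  have key : ∀ j : ℕ, ∀ f g m, m ≤ ε + j * η → Cn α p₁ a m f → Cn α p₁ a m g →
    ∃ f' g' m', Cn α p₁ a m' f' ∧ Cn α p₁ a m' g' ∧ m' ≤ ε ∧
      (_root_.Pop α β p₁ p₂)^[N * j] f - (_root_.Pop α β p₁ p₂)^[N * j] g = f' - g' := by
    intro j
    induction j with
    | zero =>
      intro f g m hm hf hg
      exact ⟨f, g, m, hf, hg, by simpa using hm, rfl⟩
    | succ j ih =>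
      intro f g m hm hf hg
      by_cases hme : m ≤ ε
      · exact ⟨_, _, m, hf.iter hα hα1 hβ hp₁ hp₂ hp _, hg.iter hα hα1 hβ hp₁ hp₂ hp _, hme, rfl⟩
      · push Not at hme
        have f1 := (hf.iter hα hα1 hβ hp₁ hp₂ hp N).sub_const hα hα1 hβ hp₁ hp₂ hp hη
          (hlow f m hf hme.le)
        have g1 := (hg.iter hα hα1 hβ hp₁ hp₂ hp N).sub_const hα hα1 hβ hp₁ hp₂ hp hη
          (hlow g m hg hme.le)
        obtain ⟨f', g', m', hf', hg', hm', he⟩ := ih _ _ _ (by push_cast at hm; linarith) f1 g1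
        refine ⟨f', g', m', hf', hg', hm', ?_⟩
        rw [← he, Nat.mul_succ, Function.iterate_add_apply, Function.iterate_add_apply,
          iter_sub hα hα1 hβ hp₁ hp₂ hp _ _ (N * j), iter_sub hα hα1 hβ hp₁ hp₂ hp _ _ (N * j)]
        congr 1
        funext x
        simp
  obtain ⟨j, hj⟩ := exists_nat_gt ((p₁ * a / 3 - ε) / η)
  rw [div_lt_iff₀ hη] at hj
  exact ⟨N * j, fun f g m hf hg => key j f g m (by linarith [hf.le]) hf hg⟩

lemma contract {α β p₁ p₂ : ℝ} (hα : 0 < α) (hα1 : α < 1) (hβ : 0 < β) (hp₁ : 0 < p₁) (hp₂ : 0 < p₂)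
    (hp : p₁ + p₂ = 1)
    (a ε : ℝ) (hε : 0 < ε) : ∃ M : ℕ, ∀ f g m, Cn α p₁ a m f → Cn α p₁ a m g →
    ∀ n, M ≤ n → ∀ x ∈ Ioc (0 : ℝ) 1,
      |(_root_.Pop α β p₁ p₂)^[n] f x - (_root_.Pop α β p₁ p₂)^[n] g x| ≤ ε / x := by
  obtain ⟨M, hM⟩ := coupling hα hα1 hβ hp₁ hp₂ hp a ε hε
  refine ⟨M, fun f g m hf hg n hn x hx => ?_⟩
  obtain ⟨f', g', m', hf', hg', hm', he⟩ := hM f g m hf hg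
  obtain ⟨k, rfl⟩ := Nat.exists_eq_add_of_le' hn
  have e : (_root_.Pop α β p₁ p₂)^[k + M] f - (_root_.Pop α β p₁ p₂)^[k + M] g =
      (_root_.Pop α β p₁ p₂)^[k] f' - (_root_.Pop α β p₁ p₂)^[k] g' := by
    rw [Function.iterate_add_apply, Function.iterate_add_apply,
          iter_sub hα hα1 hβ hp₁ hp₂ hp _ _ k, iter_sub hα hα1 hβ hp₁ hp₂ hp _ _ k, he]
  have e' := congrFun e x
  simp only [Pi.sub_apply] at e'
  rw [e']
  have cf := hf'.iter hα hα1 hβ hp₁ hp₂ hp k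
  have cg := hg'.iter hα hα1 hβ hp₁ hp₂ hp k
  have uf := cf.toKK.le_mass_div hα1 hx
  have ug := cg.toKK.le_mass_div hα1 hx
  rw [cf.ms] at uf
  rw [cg.ms] at ug
  have : m' / x ≤ ε / x := div_le_div_of_nonneg_right hm' hx.1.le
  rw [abs_le]
  constructor <;> linarith [cf.nonneg x hx, cg.nonneg x hx]

lemma Pop_tendsto {α β p₁ p₂ : ℝ}
    (hα : 0 < α) (hβ : 0 < β) {f : ℕ → ℝ → ℝ} {h : ℝ → ℝ}
    (hf : ∀ x ∈ Ioc (0 : ℝ) 1, Tendsto (fun n => f n x) atTop (nhds (h x))) :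
    ∀ x ∈ Ioc (0 : ℝ) 1, Tendsto (fun n => _root_.Pop α β p₁ p₂ (f n) x) atTop
      (nhds (_root_.Pop α β p₁ p₂ h x)) := by
  intro x hx
  unfold _root_.Pop Lop
  have h1 := hf _ (gI_mem' hα hx)
  have h2 := hf _ (gI_mem' hβ hx)
  have h3 := hf _ (half_mem hx)
  exact (((h1.div_const _).add (h3.div_const _)).const_mul _).add
    (((h2.div_const _).add (h3.div_const _)).const_mul _)

lemma Pop_eqOn {α β p₁ p₂ : ℝ}
    (hα : 0 < α) (hβ : 0 < β) {f g : ℝ → ℝ}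
    (hf : EqOn f g (Ioc 0 1)) : EqOn (_root_.Pop α β p₁ p₂ f) (_root_.Pop α β p₁ p₂ g) (Ioc 0 1) := by
  intro x hx
  unfold _root_.Pop Lop
  rw [hf (gI_mem' hα hx), hf (gI_mem' hβ hx), hf (half_mem hx)]

lemma exists_h {α β p₁ p₂ : ℝ} (hα : 0 < α) (hα1 : α < 1) (hβ : 0 < β) (hp₁ : 0 < p₁) (hp₂ : 0 < p₂)
    (hp : p₁ + p₂ = 1)
    : ∃ (h : ℝ → ℝ) (a : ℝ), KK α a h ∧ mass h = 1 ∧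
    EqOn (_root_.Pop α β p₁ p₂ h) h (Ioc 0 1) := by
  have h1c : Cn α p₁ (3 / p₁) 1 (fun _ => (1 : ℝ)) := by
    refine ⟨⟨fun x hx => zero_le_one, fun x hx y hy hxy => le_rfl, fun x hx => ?_⟩, ?_, ?_⟩
    · have h1 := one_le_rpow_neg hα hx
      have h2 : 1 ≤ 3 / p₁ := by rw [le_div_iff₀ hp₁]; linarith
      nlinarith
    · simp [mass]
    · field_simp; exact le_rfl
  set F : ℕ → ℝ → ℝ := fun n => (_root_.Pop α β p₁ p₂)^[n] (fun _ => (1 : ℝ)) with hF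
  have cF : ∀ n, Cn α p₁ (3 / p₁) 1 (F n) := fun n => h1c.iter hα hα1 hβ hp₁ hp₂ hp n
  have hlim : ∀ x : ℝ, ∃ l : ℝ, x ∈ Ioc (0 : ℝ) 1 → Tendsto (fun n => F n x) atTop (nhds l) := by
    intro x
    by_cases hx : x ∈ Ioc (0 : ℝ) 1
    · have hC : CauchySeq (fun n => F n x) := by
        rw [Metric.cauchySeq_iff']
        intro ε hε
        obtain ⟨M, hM⟩ := contract hα hα1 hβ hp₁ hp₂ hp (3 / p₁) (ε * x / 2)
          (by have := hx.1; positivity)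
        refine ⟨M, fun n hn => ?_⟩
        obtain ⟨k, rfl⟩ := Nat.exists_eq_add_of_le hn
        have := hM _ _ 1 (cF k) h1c M le_rfl x hx
        rw [Real.dist_eq]
        have e : F (M + k) = (_root_.Pop α β p₁ p₂)^[M] (F k) := by
          simp only [hF]; rw [Function.iterate_add_apply]
        rw [e]
        refine lt_of_le_of_lt this ?_
        have := hx.1
        field_simp
        norm_num
      obtain ⟨l, hl⟩ := cauchySeq_tendsto_of_complete hC
      exact ⟨l, fun _ => hl⟩
    · exact ⟨0, fun h => absurd h hx⟩
  choose h hh using hlim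
  have kh : KK α (3 / p₁) h := by
    refine ⟨fun x hx => ?_, fun x hx y hy hxy => ?_, fun x hx => ?_⟩
    · exact ge_of_tendsto' (hh x hx) (fun n => (cF n).nonneg x hx)
    · exact le_of_tendsto_of_tendsto' (hh y hy) (hh x hx) (fun n => (cF n).anti hx hy hxy)
    · exact le_of_tendsto' (hh x hx) (fun n => (cF n).bd x hx)
  refine ⟨h, 3 / p₁, kh, ?_, ?_⟩
  · have : Tendsto (fun n => mass (F n)) atTop (nhds (mass h)) := by
      unfold mass
      refine tendsto_integral_of_dominated_convergence (fun x => 3 / p₁ * x ^ (-α))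
        (fun n => (aemeas_of_anti (cF n).anti).aestronglyMeasurable)
        ((integrable_rpow_neg hα1).const_mul _) (fun n => ?_) ?_
      · filter_upwards [ae_restrict_mem measurableSet_Ioc] with x hx
        rw [Real.norm_of_nonneg ((cF n).nonneg x hx)]
        exact (cF n).bd x hx
      · filter_upwards [ae_restrict_mem measurableSet_Ioc] with x hx using hh x hx
    refine tendsto_nhds_unique this ?_
    simp only [fun n => (cF n).ms]
    exact tendsto_const_nhds
  · intro x hx
    have h1 := Pop_tendsto (p₁ := p₁) (p₂ := p₂) hα hβ hh x hx
    have h2 := (hh x hx).comp (tendsto_add_atTop_nat 1)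
    refine tendsto_nhds_unique h1 (h2.congr (fun n => ?_))
    simp only [hF, Function.comp_apply]
    rw [Function.iterate_succ_apply']

/-- pointwise convergence of the iterated annealed operator -/
lemma iter_tendsto {α β p₁ p₂ : ℝ} (hα : 0 < α) (hα1 : α < 1) (hβ : 0 < β) (hp₁ : 0 < p₁) (hp₂ : 0 < p₂)
    (hp : p₁ + p₂ = 1)
    {h : ℝ → ℝ} {b : ℝ} (kh : KK α b h) (mh : mass h = 1)
    (hfix : EqOn (_root_.Pop α β p₁ p₂ h) h (Ioc 0 1)) {f : ℝ → ℝ} {a : ℝ} (kf : KK α a f) :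
    (∃ c, ∀ n, Cn α p₁ c (mass f) ((_root_.Pop α β p₁ p₂)^[n] f)) ∧
    ∀ x ∈ Ioc (0 : ℝ) 1, Tendsto (fun n => (_root_.Pop α β p₁ p₂)^[n] f x) atTop
      (nhds (mass f * h x)) := by
  have hm := kf.mass_nonneg
  have ha := kf.a_nonneg
  have hb := kh.a_nonneg
  set m := mass f with hmdef
  set c := a + m * b + 3 * m / p₁ with hc
  have hmc : m ≤ p₁ * c / 3 := by
    have : p₁ * c / 3 = p₁ * (a + m * b) / 3 + m := by rw [hc]; field_simp
    rw [this]
    have : 0 ≤ p₁ * (a + m * b) / 3 := by positivity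
    linarith
  have h3 : 0 ≤ 3 * m / p₁ := by positivity
  have cf : Cn α p₁ c m f := ⟨kf.mono (by nlinarith [mul_nonneg hm hb]), rfl, hmc⟩
  have cg : Cn α p₁ c m (fun x => m * h x) := by
    refine ⟨⟨fun x hx => mul_nonneg hm (kh.nonneg x hx), fun x hx y hy hxy =>
      mul_le_mul_of_nonneg_left (kh.anti hx hy hxy) hm, fun x hx => ?_⟩, ?_, hmc⟩
    · have h1 := mul_le_mul_of_nonneg_left (kh.bd x hx) hm
      have h2 : 0 ≤ x ^ (-α) := Real.rpow_nonneg hx.1.le _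
      have h4 : m * b * x ^ (-α) ≤ c * x ^ (-α) := by
        apply mul_le_mul_of_nonneg_right _ h2
        linarith
      linarith
    · unfold mass at mh ⊢
      rw [integral_const_mul, mh, mul_one]
  have hg : ∀ n, EqOn ((_root_.Pop α β p₁ p₂)^[n] (fun x => m * h x)) (fun x => m * h x)
      (Ioc 0 1) := by
    intro n
    induction n with
    | zero => exact fun x _ => rfl
    | succ n ih =>
      rw [Function.iterate_succ_apply']
      refine (Pop_eqOn hα hβ ih).trans ?_
      intro x hx
      have := hfix hx
      simp only
      rw [← this]
      simp only [_root_.Pop, Lop]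
      ring
  refine ⟨⟨c, fun n => cf.iter hα hα1 hβ hp₁ hp₂ hp n⟩, fun x hx => ?_⟩
  rw [Metric.tendsto_atTop]
  intro ε hε
  obtain ⟨M, hM⟩ := contract hα hα1 hβ hp₁ hp₂ hp c (ε * x / 2)
    (by have := hx.1; positivity)
  refine ⟨M, fun n hn => ?_⟩
  have := hM _ _ m cf cg n hn x hx
  rw [hg n hx] at this
  rw [Real.dist_eq]
  refine lt_of_le_of_lt this ?_
  have := hx.1
  field_simp
  norm_num

end cone

/-! ### The skew product -/

/-- product measure `f dx ⊗ 1_{[0,c)} dω` -/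
def mu (f : ℝ → ℝ) (c : ℝ) : Measure (ℝ × ℝ) := (mm f).prod (volume.restrict (Ico 0 c))

instance mm_sfinite (f : ℝ → ℝ) : SFinite (mm f) := by unfold mm; infer_instance

lemma mm_finite {α a : ℝ} {f : ℝ → ℝ} (hα1 : α < 1) (hf : KK α a f) : IsFiniteMeasure (mm f) :=
  ⟨by rw [mm_univ hα1 hf]; exact ENNReal.ofReal_lt_top⟩

lemma mu_finite {α a : ℝ} {f : ℝ → ℝ} (hα1 : α < 1) (hf : KK α a f) (c : ℝ) :
    IsFiniteMeasure (mu f c) := by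
  have := mm_finite hα1 hf
  unfold mu; infer_instance

lemma mu_univ {α a c : ℝ} {f : ℝ → ℝ} (hα1 : α < 1) (hf : KK α a f) (hc : 0 ≤ c) :
    (mu f c).real univ = mass f * c := by
  unfold mu Measure.real
  rw [← univ_prod_univ, Measure.prod_prod, mm_univ hα1 hf]
  simp [ENNReal.toReal_ofReal hf.mass_nonneg, ENNReal.toReal_ofReal hc]

lemma skew_measurable (α β p₁ p₂ : ℝ) : Measurable (skew α β p₁ p₂) := by
  unfold skew lsv sel phiMap
  have h1 : MeasurableSet {z : ℝ × ℝ | z.2 < p₁} := measurableSet_lt measurable_snd measurable_const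
  have h2 : MeasurableSet {z : ℝ × ℝ | z.1 ≤ 1 / 2} :=
    measurableSet_le measurable_fst measurable_const
  have hs : Measurable (fun z : ℝ × ℝ => if z.2 < p₁ then α else β) :=
    Measurable.ite h1 measurable_const measurable_const
  refine Measurable.prodMk (Measurable.ite h2 ?_ ?_) (Measurable.ite h1 ?_ ?_)
  · exact measurable_fst.mul (measurable_const.add ((measurable_const.pow hs).mul
      (measurable_fst.pow hs)))
  all_goals fun_prop

lemma map_aff {p : ℝ} (hp : 0 < p) (q d : ℝ) :
    (volume.restrict (Ico q (q + p * d))).map (fun ω => (ω - q) / p) =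
      ENNReal.ofReal p • (volume.restrict (Ico (0 : ℝ) d)) := by
  have hpre : Ico q (q + p * d) = (fun ω => (ω - q) / p) ⁻¹' Ico (0 : ℝ) d := by
    ext ω
    simp only [mem_Ico, mem_preimage]
    rw [le_div_iff₀ hp, div_lt_iff₀ hp]
    constructor <;> rintro ⟨h1, h2⟩ <;> constructor <;> linarith
  have hm : Measurable (fun ω : ℝ => (ω - q) / p) := by fun_prop
  rw [hpre, ← Measure.restrict_map hm measurableSet_Ico]
  have : (volume : Measure ℝ).map (fun ω => (ω - q) / p) = ENNReal.ofReal p • volume := by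
    have h1 : (fun ω : ℝ => (ω - q) / p) = (fun x => p⁻¹ * x) ∘ (fun ω => ω - q) := by
      funext ω; simp [div_eq_inv_mul]
    rw [h1, ← Measure.map_map (by fun_prop) (by fun_prop), map_sub_right_eq_self,
      Real.map_volume_mul_left (by positivity), inv_inv, abs_of_pos hp]
  rw [this, Measure.restrict_smul]

lemma hasSum_real_iUnion {μ : Measure (ℝ × ℝ)} [IsFiniteMeasure μ] {F : ℕ → Set (ℝ × ℝ)}
    (hd : Pairwise (Function.onFun Disjoint F)) (hm : ∀ i, MeasurableSet (F i)) :
    HasSum (fun i => μ.real (F i)) (μ.real (⋃ i, F i)) := by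
  unfold Measure.real
  have hU := measure_iUnion hd hm (μ := μ)
  have hne : ∑' i, μ (F i) ≠ ⊤ := by rw [← hU]; exact measure_ne_top _ _
  rw [hU, ENNReal.tsum_toReal_eq (fun i => measure_ne_top _ _)]
  exact ENNReal.hasSum_toReal hne

section skewprod
lemma piece {α β p₁ p₂ γ p q d : ℝ} (hγ : 0 < γ) (hp : 0 < p) {f : ℝ → ℝ} {a : ℝ} (hf : KK α a f)
    (hS : ∀ x, ∀ ω ∈ Ico q (q + p * d), skew α β p₁ p₂ (x, ω) = (lsv γ x, (ω - q) / p)) :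
    ((mm f).prod (volume.restrict (Ico q (q + p * d)))).map (skew α β p₁ p₂) =
      ENNReal.ofReal p • mu (Lop γ f) d := by
  have hm : Measurable (fun ω : ℝ => (ω - q) / p) := by fun_prop
  have h1 : ((mm f).prod (volume.restrict (Ico q (q + p * d)))).map (skew α β p₁ p₂) =
      ((mm f).prod (volume.restrict (Ico q (q + p * d)))).map
        (Prod.map (lsv γ) (fun ω => (ω - q) / p)) := by
    apply Measure.map_congr
    have := (Measure.quasiMeasurePreserving_snd (μ := mm f)
      (ν := volume.restrict (Ico q (q + p * d)))).ae (ae_restrict_mem measurableSet_Ico)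
    filter_upwards [this] with z hz
    exact hS z.1 z.2 hz
  rw [h1, ← Measure.map_prod_map _ _ (lsv_measurable γ) hm, map_aff hp,
    map_mm hγ hf.nonneg hf.anti, Measure.prod_smul_right]
  rfl

lemma skew_left {α β p₁ p₂ : ℝ} (x : ℝ) {ω : ℝ} (h : ω < p₁) :
    skew α β p₁ p₂ (x, ω) = (lsv α x, (ω - 0) / p₁) := by
  simp [skew, sel, phiMap, h]

lemma skew_right {α β p₁ p₂ : ℝ} (x : ℝ) {ω : ℝ} (h : p₁ ≤ ω) :
    skew α β p₁ p₂ (x, ω) = (lsv β x, (ω - p₁) / p₂) := by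
  simp [skew, sel, phiMap, not_lt.2 h]

lemma map_small {α β p₁ p₂ : ℝ} (hα : 0 < α) (hα1 : α < 1) (hβ : 0 < β) (hp₁ : 0 < p₁) (hp₂ : 0 < p₂)
    (hp : p₁ + p₂ = 1)
    {f : ℝ → ℝ} {a d : ℝ} (hf : KK α a f) (hd : d ≤ 1) :
    (mu f (p₁ * d)).map (skew α β p₁ p₂) = ENNReal.ofReal p₁ • mu (Lop α f) d := by
  have := piece (β := β) (p₁ := p₁) (p₂ := p₂) (q := 0) (d := d) hα hp₁ hf (fun x ω hω => skew_left x (by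
    have := hω.2; nlinarith))
  rw [zero_add] at this
  exact this

lemma map_big {α β p₁ p₂ : ℝ} (hα : 0 < α) (hα1 : α < 1) (hβ : 0 < β) (hp₁ : 0 < p₁) (hp₂ : 0 < p₂)
    (hp : p₁ + p₂ = 1)
    {f : ℝ → ℝ} {a d : ℝ} (hf : KK α a f) (hd : 0 ≤ d) :
    (mu f (p₁ + p₂ * d)).map (skew α β p₁ p₂) =
      ENNReal.ofReal p₁ • mu (Lop α f) 1 + ENNReal.ofReal p₂ • mu (Lop β f) d := by
  have h1 := map_small hα hα1 hβ hp₁ hp₂ hp hf le_rfl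
  have h2 := piece (p₁ := p₁) (p₂ := p₂) (q := p₁) (d := d) hβ hp₂ hf
    (fun x ω hω => skew_right x hω.1)
  rw [← h1, ← h2, ← Measure.map_add _ _ (skew_measurable _ _ _ _)]
  unfold mu
  rw [← Measure.prod_add, ← Measure.restrict_union (by
    rw [Set.disjoint_left]; intro x hx hx'; exact absurd hx.2 (by simpa using hx'.1))
    measurableSet_Ico, mul_one, Ico_union_Ico_eq_Ico hp₁.le (by nlinarith)]

lemma mu_Pop {α β p₁ p₂ : ℝ} (hα : 0 < α) (hα1 : α < 1) (hβ : 0 < β) (hp₁ : 0 < p₁) (hp₂ : 0 < p₂)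
    (hp : p₁ + p₂ = 1)
    {f : ℝ → ℝ} {a : ℝ} (hf : KK α a f) :
    mu (_root_.Pop α β p₁ p₂ f) 1 =
      ENNReal.ofReal p₁ • mu (Lop α f) 1 + ENNReal.ofReal p₂ • mu (Lop β f) 1 := by
  have k1 := hf.Lop hα hα1 hα
  have k2 := hf.Lop hα hα1 hβ
  have : mm (_root_.Pop α β p₁ p₂ f) =
      ENNReal.ofReal p₁ • mm (Lop α f) + ENNReal.ofReal p₂ • mm (Lop β f) := by
    have hadd : (volume.restrict (Ioc (0 : ℝ) 1)).withDensity
        ((ENNReal.ofReal p₁ • fun x => ENNReal.ofReal (Lop α f x)) +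
          (ENNReal.ofReal p₂ • fun x => ENNReal.ofReal (Lop β f x))) =
        (volume.restrict (Ioc (0 : ℝ) 1)).withDensity
          (ENNReal.ofReal p₁ • fun x => ENNReal.ofReal (Lop α f x)) +
        (volume.restrict (Ioc (0 : ℝ) 1)).withDensity
          (ENNReal.ofReal p₂ • fun x => ENNReal.ofReal (Lop β f x)) := by
      ext A hA
      rw [Measure.add_apply, withDensity_apply _ hA, withDensity_apply _ hA,
        withDensity_apply _ hA]
      exact lintegral_add_left' (((aemeas_of_anti k1.anti).ennreal_ofReal.const_smul _).mono_measure
        Measure.restrict_le_self) _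
    unfold mm
    rw [← withDensity_smul' _ _ ENNReal.ofReal_ne_top, ← withDensity_smul' _ _ ENNReal.ofReal_ne_top,
      ← hadd]
    apply withDensity_congr_ae
    filter_upwards [ae_restrict_mem measurableSet_Ioc] with x hx
    have := k1.nonneg x hx
    have := k2.nonneg x hx
    simp only [_root_.Pop, Pi.add_apply, Pi.smul_apply, smul_eq_mul]
    rw [ENNReal.ofReal_add (by positivity) (by positivity), ENNReal.ofReal_mul hp₁.le,
      ENNReal.ofReal_mul hp₂.le]
  unfold mu
  rw [this, Measure.add_prod, Measure.prod_smul_left, Measure.prod_smul_left]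

lemma mu_map_one {α β p₁ p₂ : ℝ} (hα : 0 < α) (hα1 : α < 1) (hβ : 0 < β) (hp₁ : 0 < p₁) (hp₂ : 0 < p₂)
    (hp : p₁ + p₂ = 1)
    {f : ℝ → ℝ} {a : ℝ} (hf : KK α a f) :
    (mu f 1).map (skew α β p₁ p₂) = mu (_root_.Pop α β p₁ p₂ f) 1 := by
  rw [mu_Pop hα hα1 hβ hp₁ hp₂ hp hf, ← map_big hα hα1 hβ hp₁ hp₂ hp hf zero_le_one, mul_one, hp]

lemma map_iter {α β p₁ p₂ : ℝ} (hα : 0 < α) (hα1 : α < 1) (hβ : 0 < β) (hp₁ : 0 < p₁) (hp₂ : 0 < p₂)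
    (hp : p₁ + p₂ = 1)
    {f : ℝ → ℝ} {c m : ℝ} (hf : Cn α p₁ c m f) (n : ℕ) :
    (mu f 1).map (skew α β p₁ p₂)^[n] = mu ((_root_.Pop α β p₁ p₂)^[n] f) 1 := by
  induction n with
  | zero => simp
  | succ n ih =>
    rw [Function.iterate_succ_apply', Function.iterate_succ',
      ← Measure.map_map (skew_measurable _ _ _ _) ((skew_measurable _ _ _ _).iterate n), ih,
      mu_map_one hα hα1 hβ hp₁ hp₂ hp (hf.iter hα hα1 hβ hp₁ hp₂ hp n).toKK]

lemma mu_apply {α : ℝ}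
    {f : ℝ → ℝ} {a : ℝ} (hf : KK α a f) {A : Set (ℝ × ℝ)} (hA : MeasurableSet A) :
    mu f 1 A = ∫⁻ x in Ioc (0 : ℝ) 1, ENNReal.ofReal (f x) *
      volume.restrict (Ico (0 : ℝ) 1) (Prod.mk x ⁻¹' A) := by
  unfold mu
  rw [Measure.prod_apply hA]
  unfold mm
  rw [lintegral_withDensity_eq_lintegral_mul₀ (aemeas_of_anti hf.anti).ennreal_ofReal
    (measurable_measure_prodMk_left hA).aemeasurable]
  rfl

lemma mix_full {α β p₁ p₂ : ℝ} (hα : 0 < α) (hα1 : α < 1) (hβ : 0 < β) (hp₁ : 0 < p₁) (hp₂ : 0 < p₂)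
    (hp : p₁ + p₂ = 1)
    {h : ℝ → ℝ} {b : ℝ} (kh : KK α b h) (mh : mass h = 1)
    (hfix : EqOn (_root_.Pop α β p₁ p₂ h) h (Ioc 0 1))
    {f : ℝ → ℝ} {a : ℝ} (hf : KK α a f) {A : Set (ℝ × ℝ)} (hA : MeasurableSet A) :
    Tendsto (fun n => (mu f 1).real ((skew α β p₁ p₂)^[n] ⁻¹' A)) atTop
      (nhds (mass f * (mu h 1).real A)) := by
  obtain ⟨⟨c, hc⟩, hlim⟩ := iter_tendsto hα hα1 hβ hp₁ hp₂ hp kh mh hfix hf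
  have hfin := mu_finite hα1 kh 1
  have c0 : Cn α p₁ c (mass f) f := hc 0
  have e1 : ∀ n, (mu f 1) ((skew α β p₁ p₂)^[n] ⁻¹' A) =
      mu ((_root_.Pop α β p₁ p₂)^[n] f) 1 A := by
    intro n
    rw [← map_iter hα hα1 hβ hp₁ hp₂ hp c0 n,
      Measure.map_apply ((skew_measurable _ _ _ _).iterate n) hA]
  have hT : Tendsto (fun n => (mu f 1) ((skew α β p₁ p₂)^[n] ⁻¹' A)) atTop
      (nhds (ENNReal.ofReal (mass f) * mu h 1 A)) := by
    simp only [e1, fun n => mu_apply (hc n).toKK hA]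
    have e2 : ENNReal.ofReal (mass f) * mu h 1 A = ∫⁻ x in Ioc (0 : ℝ) 1,
        ENNReal.ofReal (mass f * h x) * volume.restrict (Ico (0 : ℝ) 1) (Prod.mk x ⁻¹' A) := by
      rw [mu_apply kh hA, ← lintegral_const_mul' _ _ ENNReal.ofReal_ne_top]
      congr 1
      funext x
      rw [ENNReal.ofReal_mul hf.mass_nonneg, mul_assoc]
    rw [e2]
    refine tendsto_lintegral_of_dominated_convergence' (fun x => ENNReal.ofReal (c * x ^ (-α)))
      (fun n => (aemeas_of_anti (hc n).anti).ennreal_ofReal.mul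
        (measurable_measure_prodMk_left hA).aemeasurable) (fun n => ?_) ?_ ?_
    · filter_upwards [ae_restrict_mem measurableSet_Ioc] with x hx
      calc _ ≤ ENNReal.ofReal ((_root_.Pop α β p₁ p₂)^[n] f x) * 1 := by
            gcongr
            refine (measure_mono (subset_univ _)).trans ?_
            simp
        _ ≤ _ := by
            rw [mul_one]
            exact ENNReal.ofReal_le_ofReal ((hc n).bd x hx)
    · exact ((integrable_rpow_neg hα1).const_mul c).lintegral_lt_top.ne
    · filter_upwards [ae_restrict_mem measurableSet_Ioc] with x hx
      refine ENNReal.Tendsto.mul_const (ENNReal.tendsto_ofReal (hlim x hx)) (Or.inr ?_)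
      exact measure_ne_top _ _
  have := (ENNReal.tendsto_toReal (ENNReal.mul_ne_top ENNReal.ofReal_ne_top
    (measure_ne_top _ _))).comp hT
  rw [ENNReal.toReal_mul, ENNReal.toReal_ofReal hf.mass_nonneg] at this
  exact this

lemma iter_real {α β p₁ p₂ : ℝ} (hα : 0 < α) (hα1 : α < 1) (hβ : 0 < β) (hp₁ : 0 < p₁) (hp₂ : 0 < p₂)
    (hp : p₁ + p₂ = 1)
    {h : ℝ → ℝ} {b : ℝ} (kh : KK α b h) (mh : mass h = 1)
    (hfix : EqOn (_root_.Pop α β p₁ p₂ h) h (Ioc 0 1))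
    {f : ℝ → ℝ} {c : ℝ} {A : Set (ℝ × ℝ)} (hA : MeasurableSet A) (n : ℕ) :
    (mu f c).real ((skew α β p₁ p₂)^[n + 1] ⁻¹' A) =
      ((mu f c).map (skew α β p₁ p₂)).real ((skew α β p₁ p₂)^[n] ⁻¹' A) := by
  unfold Measure.real
  rw [Measure.map_apply (skew_measurable _ _ _ _) (((skew_measurable _ _ _ _).iterate n) hA),
    ← preimage_comp, ← Function.iterate_succ]

lemma mix_approx {α β p₁ p₂ : ℝ} (hα : 0 < α) (hα1 : α < 1) (hβ : 0 < β) (hp₁ : 0 < p₁) (hp₂ : 0 < p₂)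
    (hp : p₁ + p₂ = 1)
    {h : ℝ → ℝ} {b : ℝ} (kh : KK α b h) (mh : mass h = 1)
    (hfix : EqOn (_root_.Pop α β p₁ p₂ h) h (Ioc 0 1))
    {A : Set (ℝ × ℝ)} (hA : MeasurableSet A) (k : ℕ) :
    ∀ a f, KK α a f → ∀ c ∈ Icc (0 : ℝ) 1, ∀ ε > 0, ∀ᶠ n in atTop,
      |(mu f c).real ((skew α β p₁ p₂)^[n] ⁻¹' A) - mass f * c * (mu h 1).real A| ≤
        (max p₁ p₂) ^ k * mass f + ε := by
  have hν0 : 0 ≤ (mu h 1).real A := measureReal_nonneg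
  have hν1 : (mu h 1).real A ≤ 1 := by
    have := mu_finite hα1 kh 1
    calc (mu h 1).real A ≤ (mu h 1).real univ := measureReal_mono (subset_univ _)
      _ = 1 := by rw [mu_univ hα1 kh zero_le_one, mh, mul_one]
  induction k with
  | zero =>
    intro a f hf c hc ε hε
    refine Eventually.of_forall (fun n => ?_)
    have := mu_finite hα1 hf c
    have h0 : 0 ≤ (mu f c).real ((skew α β p₁ p₂)^[n] ⁻¹' A) := measureReal_nonneg
    have h1 : (mu f c).real ((skew α β p₁ p₂)^[n] ⁻¹' A) ≤ mass f * c := by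
      rw [← mu_univ hα1 hf hc.1]
      exact measureReal_mono (subset_univ _)
    have hm := hf.mass_nonneg
    have h2 : mass f * c ≤ mass f := mul_le_of_le_one_right hm hc.2
    have h3 : 0 ≤ mass f * c := mul_nonneg hm hc.1
    have h4 : mass f * c * (mu h 1).real A ≤ mass f * c := mul_le_of_le_one_right h3 hν1
    have h5 : 0 ≤ mass f * c * (mu h 1).real A := mul_nonneg h3 hν0
    rw [pow_zero, one_mul, abs_le]
    constructor <;> linarith
  | succ k ih =>
    intro a f hf c hc ε hε
    have k1 := hf.Lop hα hα1 hα
    have k2 := hf.Lop hα hα1 hβ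
    have m1 := mass_Lop hα hα1 hα hf
    have m2 := mass_Lop hα hα1 hβ hf
    have hm := hf.mass_nonneg
    set q := max p₁ p₂ with hq
    have hq0 : 0 ≤ q := hp₁.le.trans (le_max_left _ _)
    have hqk : 0 ≤ q ^ k * mass f := by positivity
    have hq1 : p₁ * (q ^ k * mass f) ≤ q ^ (k + 1) * mass f := by
      rw [pow_succ', mul_assoc]
      exact mul_le_mul_of_nonneg_right (le_max_left _ _) hqk
    have hq2 : p₂ * (q ^ k * mass f) ≤ q ^ (k + 1) * mass f := by
      rw [pow_succ', mul_assoc]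
      exact mul_le_mul_of_nonneg_right (le_max_right _ _) hqk
    rw [← Filter.map_add_atTop_eq_nat 1, Filter.eventually_map]
    by_cases hcp : c ≤ p₁
    · obtain ⟨d, rfl⟩ : ∃ d, c = p₁ * d := ⟨c / p₁, by field_simp⟩
      have hd0 : 0 ≤ d := by
        have := hc.1
        by_contra hd
        push Not at hd
        nlinarith
      have hd1 : d ≤ 1 := by
        by_contra hd
        push Not at hd
        nlinarith
      filter_upwards [ih _ _ k1 d ⟨hd0, hd1⟩ ε hε] with n hn
      rw [iter_real hα hα1 hβ hp₁ hp₂ hp kh mh hfix hA, map_small hα hα1 hβ hp₁ hp₂ hp hf hd1,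
        measureReal_ennreal_smul_apply, ENNReal.toReal_ofReal hp₁.le]
      rw [m1] at hn
      have e : ∀ G V : ℝ, p₁ * G - mass f * (p₁ * d) * V = p₁ * (G - mass f * d * V) := by
        intros; ring
      rw [e, abs_mul, abs_of_pos hp₁]
      have := mul_le_mul_of_nonneg_left hn hp₁.le
      nlinarith
    · push Not at hcp
      obtain ⟨d, rfl⟩ : ∃ d, c = p₁ + p₂ * d := ⟨(c - p₁) / p₂, by field_simp; ring⟩
      have hd0 : 0 ≤ d := by
        by_contra hd
        push Not at hd
        nlinarith
      have hd1 : d ≤ 1 := by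
        have := hc.2
        by_contra hd
        push Not at hd
        nlinarith
      have hfull := mix_full hα hα1 hβ hp₁ hp₂ hp kh mh hfix k1 hA
      rw [Metric.tendsto_atTop'] at hfull
      obtain ⟨N, hN⟩ := hfull ε hε
      filter_upwards [ih _ _ k2 d ⟨hd0, hd1⟩ ε hε, eventually_gt_atTop N] with n hn hnN
      have hn1 := (hN n hnN).le
      rw [Real.dist_eq, m1] at hn1
      rw [m2] at hn
      have f1 := mu_finite hα1 k1 1
      have f2 := mu_finite hα1 k2 d
      rw [iter_real hα hα1 hβ hp₁ hp₂ hp kh mh hfix hA, map_big hα hα1 hβ hp₁ hp₂ hp hf hd0]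
      have e : (ENNReal.ofReal p₁ • mu (Lop α f) 1 + ENNReal.ofReal p₂ • mu (Lop β f) d).real
          ((skew α β p₁ p₂)^[n] ⁻¹' A) =
          p₁ * (mu (Lop α f) 1).real ((skew α β p₁ p₂)^[n] ⁻¹' A) +
          p₂ * (mu (Lop β f) d).real ((skew α β p₁ p₂)^[n] ⁻¹' A) := by
        unfold Measure.real
        rw [Measure.add_apply, Measure.smul_apply, Measure.smul_apply, smul_eq_mul, smul_eq_mul,
          ENNReal.toReal_add (ENNReal.mul_ne_top ENNReal.ofReal_ne_top (measure_ne_top _ _))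
            (ENNReal.mul_ne_top ENNReal.ofReal_ne_top (measure_ne_top _ _)),
          ENNReal.toReal_mul, ENNReal.toReal_mul, ENNReal.toReal_ofReal hp₁.le,
          ENNReal.toReal_ofReal hp₂.le]
      rw [e]
      have e' : ∀ G G' V : ℝ, p₁ * G + p₂ * G' - mass f * (p₁ + p₂ * d) * V =
          p₁ * (G - mass f * V) + p₂ * (G' - mass f * d * V) := by
        intros; ring
      rw [e']
      refine (abs_add_le _ _).trans ?_
      rw [abs_mul, abs_mul, abs_of_pos hp₁, abs_of_pos hp₂]
      have i1 := mul_le_mul_of_nonneg_left hn1 hp₁.le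
      have i2 := mul_le_mul_of_nonneg_left hn hp₂.le
      have i3 : p₁ * ε + p₂ * ε = ε := by rw [← add_mul, hp, one_mul]
      linarith

lemma mix_rect {α β p₁ p₂ : ℝ} (hα : 0 < α) (hα1 : α < 1) (hβ : 0 < β) (hp₁ : 0 < p₁) (hp₂ : 0 < p₂)
    (hp : p₁ + p₂ = 1)
    {h : ℝ → ℝ} {b : ℝ} (kh : KK α b h) (mh : mass h = 1)
    (hfix : EqOn (_root_.Pop α β p₁ p₂ h) h (Ioc 0 1))
    {A : Set (ℝ × ℝ)} (hA : MeasurableSet A) {a : ℝ} {f : ℝ → ℝ} (hf : KK α a f)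
    {c : ℝ} (hc : c ∈ Icc (0 : ℝ) 1) :
    Tendsto (fun n => (mu f c).real ((skew α β p₁ p₂)^[n] ⁻¹' A)) atTop
      (nhds ((mu f c).real univ * (mu h 1).real A)) := by
  rw [mu_univ hα1 hf hc.1, Metric.tendsto_nhds]
  intro ε hε
  have hq1 : max p₁ p₂ < 1 := max_lt (by linarith) (by linarith)
  have hq0 : 0 ≤ max p₁ p₂ := hp₁.le.trans (le_max_left _ _)
  have ht : Tendsto (fun k : ℕ => (max p₁ p₂) ^ k * mass f) atTop (nhds 0) := by
    simpa using (tendsto_pow_atTop_nhds_zero_of_lt_one hq0 hq1).mul_const (mass f)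
  obtain ⟨k, hk⟩ := (ht.eventually (gt_mem_nhds (half_pos hε))).exists
  filter_upwards [mix_approx hα hα1 hβ hp₁ hp₂ hp kh mh hfix hA k a f hf c hc (ε / 4)
    (by linarith)] with n hn
  rw [Real.dist_eq]
  linarith

lemma restrict_rect {α β p₁ p₂ : ℝ} (hα : 0 < α) (hα1 : α < 1) (hβ : 0 < β) (hp₁ : 0 < p₁) (hp₂ : 0 < p₂)
    (hp : p₁ + p₂ = 1)
    {h : ℝ → ℝ} {b : ℝ} (kh : KK α b h) (mh : mass h = 1)
    (hfix : EqOn (_root_.Pop α β p₁ p₂ h) h (Ioc 0 1))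
    (s c : ℝ) :
    ∃ (f : ℝ → ℝ) (d : ℝ), KK α b f ∧ d ∈ Icc (0 : ℝ) 1 ∧
      (mu h 1).restrict (Iic s ×ˢ Iio c) = mu f d := by
  refine ⟨(Iic s).indicator h, max 0 (min c 1), ⟨fun x hx => ?_, fun x hx y hy hxy => ?_,
    fun x hx => ?_⟩, ⟨le_max_left _ _, max_le zero_le_one (min_le_right _ _)⟩, ?_⟩
  · exact indicator_apply_nonneg (fun _ => kh.nonneg x hx)
  · by_cases hys : y ≤ s
    · rw [indicator_of_mem (by exact hys), indicator_of_mem (by exact hxy.trans hys)]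
      exact kh.anti hx hy hxy
    · rw [indicator_of_notMem (by exact hys)]
      by_cases hxs : x ≤ s
      · rw [indicator_of_mem (by exact hxs)]; exact kh.nonneg x hx
      · rw [indicator_of_notMem (by exact hxs)]
  · refine le_trans ?_ (kh.bd x hx)
    by_cases hxs : x ≤ s
    · rw [indicator_of_mem (by exact hxs)]
    · rw [indicator_of_notMem (by exact hxs)]; exact kh.nonneg x hx
  · unfold mu
    rw [← Measure.prod_restrict]
    congr 1
    · unfold mm
      rw [restrict_withDensity measurableSet_Iic, ← withDensity_indicator measurableSet_Iic]
      congr 1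
      funext x
      by_cases hxs : x ≤ s
      · rw [indicator_of_mem (by exact hxs), indicator_of_mem (by exact hxs)]
      · rw [indicator_of_notMem (by exact hxs), indicator_of_notMem (by exact hxs)]; simp
    · rw [Measure.restrict_restrict measurableSet_Iio]
      congr 1
      ext ω
      simp only [mem_inter_iff, mem_Iio, mem_Ico, lt_max_iff, lt_min_iff]
      constructor
      · rintro ⟨h1, h2, h3⟩
        exact ⟨h2, Or.inr ⟨h1, h3⟩⟩
      · rintro ⟨h1, h2 | h2⟩
        · linarith
        · exact ⟨h2.1, h1, h2.2⟩

lemma mixing_real {α β p₁ p₂ : ℝ} (hα : 0 < α) (hα1 : α < 1) (hβ : 0 < β) (hp₁ : 0 < p₁) (hp₂ : 0 < p₂)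
    (hp : p₁ + p₂ = 1)
    {h : ℝ → ℝ} {b : ℝ} (kh : KK α b h) (mh : mass h = 1)
    (hfix : EqOn (_root_.Pop α β p₁ p₂ h) h (Ioc 0 1))
    {A : Set (ℝ × ℝ)} (hA : MeasurableSet A)
    (hinv : ∀ n, (mu h 1) ((skew α β p₁ p₂)^[n] ⁻¹' A) = mu h 1 A)
    {B : Set (ℝ × ℝ)} (hB : MeasurableSet B) :
    Tendsto (fun n => (mu h 1).real ((skew α β p₁ p₂)^[n] ⁻¹' A ∩ B)) atTop
      (nhds ((mu h 1).real A * (mu h 1).real B)) := by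
  have hfin := mu_finite hα1 kh 1
  have hgen : (inferInstance : MeasurableSpace (ℝ × ℝ)) =
      MeasurableSpace.generateFrom (image2 (· ×ˢ ·) (range (Iic : ℝ → Set ℝ)) (range (Iio : ℝ → Set ℝ))) := by
    refine (generateFrom_eq_prod ?_ ?_ ?_ ?_).symm
    · rw [← borel_eq_generateFrom_Iic]; exact (BorelSpace.measurable_eq).symm
    · rw [← borel_eq_generateFrom_Iio]; exact (BorelSpace.measurable_eq).symm
    · refine ⟨fun n : ℕ => Iic (n : ℝ), fun n => ⟨_, rfl⟩, ?_⟩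
      refine eq_univ_of_forall (fun x => mem_iUnion.2 ?_)
      obtain ⟨n, hn⟩ := exists_nat_gt x
      exact ⟨n, hn.le⟩
    · refine ⟨fun n : ℕ => Iio (n : ℝ), fun n => ⟨_, rfl⟩, ?_⟩
      refine eq_univ_of_forall (fun x => mem_iUnion.2 ?_)
      obtain ⟨n, hn⟩ := exists_nat_gt x
      exact ⟨n, hn⟩
  have hpi : IsPiSystem (image2 (· ×ˢ ·) (range (Iic : ℝ → Set ℝ)) (range (Iio : ℝ → Set ℝ))) := by
    refine IsPiSystem.prod ?_ ?_
    · rintro _ ⟨x, rfl⟩ _ ⟨y, rfl⟩ _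
      exact ⟨_, Iic_inter_Iic.symm⟩
    · rintro _ ⟨x, rfl⟩ _ ⟨y, rfl⟩ _
      exact ⟨_, Iio_inter_Iio.symm⟩
  have hSn : ∀ n, MeasurableSet ((skew α β p₁ p₂)^[n] ⁻¹' A) :=
    fun n => ((skew_measurable _ _ _ _).iterate n) hA
  induction B, hB using MeasurableSpace.induction_on_inter hgen hpi with
  | empty => simp
  | basic t ht =>
    obtain ⟨_, ⟨s, rfl⟩, _, ⟨c, rfl⟩, rfl⟩ := ht
    obtain ⟨f, d, hf, hd, he⟩ := restrict_rect hα hα1 hβ hp₁ hp₂ hp kh mh hfix s c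
    have := mix_rect hα hα1 hβ hp₁ hp₂ hp kh mh hfix hA hf hd
    rw [← he, mul_comm] at this
    simp only [measureReal_restrict_apply (hSn _), measureReal_restrict_apply_univ] at this
    exact this
  | compl t htm ih =>
    have e1 : ∀ n, (mu h 1).real ((skew α β p₁ p₂)^[n] ⁻¹' A ∩ tᶜ) =
        (mu h 1).real A - (mu h 1).real ((skew α β p₁ p₂)^[n] ⁻¹' A ∩ t) := by
      intro n
      have h1 := measureReal_inter_add_sdiff (μ := mu h 1) (s := (skew α β p₁ p₂)^[n] ⁻¹' A) htm
      have h2 : (mu h 1).real ((skew α β p₁ p₂)^[n] ⁻¹' A) = (mu h 1).real A := by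
        unfold Measure.real; rw [hinv n]
      rw [← sdiff_eq]
      linarith
    have hu : (mu h 1).real univ = 1 := by rw [mu_univ hα1 kh zero_le_one, mh, mul_one]
    rw [measureReal_compl htm, hu]
    simp only [e1]
    have := ih.const_sub ((mu h 1).real A)
    convert this using 2
    ring
  | iUnion F hd hm ih =>
    have hs : Summable (fun i => (mu h 1).real (F i)) :=
      (hasSum_real_iUnion hd hm).summable
    have e1 : ∀ n, (mu h 1).real ((skew α β p₁ p₂)^[n] ⁻¹' A ∩ ⋃ i, F i) =
        ∑' i, (mu h 1).real ((skew α β p₁ p₂)^[n] ⁻¹' A ∩ F i) := by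
      intro n
      rw [inter_iUnion]
      refine (hasSum_real_iUnion (fun i j hij => ?_) (fun i => (hSn n).inter (hm i))).tsum_eq.symm
      exact (hd hij).mono inter_subset_right inter_subset_right
    have e2 : (mu h 1).real A * (mu h 1).real (⋃ i, F i) =
        ∑' i, (mu h 1).real A * (mu h 1).real (F i) := by
      rw [tsum_mul_left, (hasSum_real_iUnion hd hm).tsum_eq]
    simp only [e1]
    rw [e2]
    refine tendsto_tsum_of_dominated_convergence hs ih (Eventually.of_forall (fun n i => ?_))
    rw [Real.norm_of_nonneg measureReal_nonneg]
    exact measureReal_mono inter_subset_right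

end skewprod

/-- For `0 < α < β ≤ 1` and `p₁, p₂ > 0` with `p₁ + p₂ = 1`, there is an
absolutely continuous `S`-invariant Borel probability measure `ν` on `[0,1] × [0,1]` such
that `(S,ν)` is mixing: `ν(S^{-n}A ∩ B) → ν(A)ν(B)` for all Borel sets `A, B`. -/
theorem skew_acip_mixing (α β p₁ p₂ : ℝ) (hα : 0 < α) (hαβ : α < β) (hβ : β ≤ 1)
    (hp₁ : 0 < p₁) (hp₂ : 0 < p₂) (hp : p₁ + p₂ = 1) :
    ∃ ν : Measure (ℝ × ℝ), IsProbabilityMeasure ν ∧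
      ν ≪ volume.restrict (Set.Icc (0 : ℝ) 1 ×ˢ Set.Icc (0 : ℝ) 1) ∧
      (∀ A : Set (ℝ × ℝ), MeasurableSet A → ν (skew α β p₁ p₂ ⁻¹' A) = ν A) ∧
      ∀ A B : Set (ℝ × ℝ), MeasurableSet A → MeasurableSet B →
        Tendsto (fun n : ℕ => ν ((skew α β p₁ p₂)^[n] ⁻¹' A ∩ B)) atTop
          (nhds (ν A * ν B)) := by
  have hα1 : α < 1 := by linarith
  have hβ0 : 0 < β := by linarith
  obtain ⟨h, b, kh, mh, hfix⟩ := exists_h hα hα1 hβ0 hp₁ hp₂ hp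
  have hfin := mu_finite hα1 kh 1
  have hmap : (mu h 1).map (skew α β p₁ p₂) = mu h 1 := by
    rw [mu_map_one hα hα1 hβ0 hp₁ hp₂ hp kh]
    unfold mu
    rw [mm_congr hfix]
  have hmp : MeasurePreserving (skew α β p₁ p₂) (mu h 1) (mu h 1) :=
    ⟨skew_measurable _ _ _ _, hmap⟩
  have hinv : ∀ n, ∀ A, MeasurableSet A →
      (mu h 1) ((skew α β p₁ p₂)^[n] ⁻¹' A) = mu h 1 A :=
    fun n A hA => (hmp.iterate n).measure_preimage hA.nullMeasurableSet
  refine ⟨mu h 1, ⟨?_⟩, ?_, fun A hA => hinv 1 A hA, fun A B hA hB => ?_⟩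
  · have h1 : (mu h 1).real univ = 1 := by rw [mu_univ hα1 kh zero_le_one, mh, mul_one]
    rw [← ENNReal.ofReal_toReal (measure_ne_top (mu h 1) univ)]
    unfold Measure.real at h1
    rw [h1, ENNReal.ofReal_one]
  · have h1 : mu h 1 ≪ (volume.restrict (Ioc (0 : ℝ) 1)).prod (volume.restrict (Ico (0 : ℝ) 1)) := by
      unfold mu mm
      exact (withDensity_absolutelyContinuous _ _).prod Measure.AbsolutelyContinuous.rfl
    refine h1.trans ?_
    rw [Measure.prod_restrict, ← Measure.volume_eq_prod]
    exact (Measure.restrict_mono (Set.prod_mono Ioc_subset_Icc_self Ico_subset_Icc_self)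
      le_rfl).absolutelyContinuous
  · have := mixing_real hα hα1 hβ0 hp₁ hp₂ hp kh mh hfix hA (fun n => hinv n A hA) hB
    have h2 := ENNReal.tendsto_ofReal this
    rw [ENNReal.ofReal_mul measureReal_nonneg] at h2
    simpa only [Measure.real, ENNReal.ofReal_toReal (measure_ne_top (mu h 1) _)] using h2
end
end
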